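/- arXiv:2406.06480 — 2 statements merged into one kernel-verified Lean document; each statement's English description precedes it below -/
import Mathlib

section
/- Let Γ be a labelled graph with vertex set V of size at least 2 whose set of cone points is exactly {t}. Then the center Z(A_Γ) is trivial if and only if there exists a vertex s ≠ t with m(s,t) ≠ 2; moreover, if m(s,t) = 2 for all s ∈ V ∖ {t}, then the cyclic subgroup generated by σ_t is contained in Z(A_Γ). -/
/-- A labelled graph: a vertex set `V` and a symmetric labelling `m : V → V → ℕ∞`
with `m u v ≥ 2` for `u ≠ v` (`m u v = ∞` means no edge). -/
structure LabelledGraph (V : Type*) where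
  m : V → V → ℕ∞
  symm : ∀ u v, m u v = m v u
  two_le : ∀ u v, u ≠ v → 2 ≤ m u v

namespace LabelledGraph

variable {V W : Type*}

/-- The alternating product `x * y * x * ⋯` with `n` terms. -/
def altProd {G : Type*} [Monoid G] (x y : G) : ℕ → G
  | 0 => 1
  | n + 1 => x * altProd y x n

/-- The alternating word `u v u v ⋯` with `n` terms in the free group. -/
def altWord (u v : V) (n : ℕ) : FreeGroup V :=
  altProd (FreeGroup.of u) (FreeGroup.of v) n

/-- The Artin relations of a labelled graph: for each `u ≠ v` with finite label
`m u v = k`, the relation `(u v u ⋯) = (v u v ⋯)` (both sides with `k` terms). -/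
def artinRels (Γ : LabelledGraph V) : Set (FreeGroup V) :=
  { r | ∃ (u v : V) (k : ℕ), u ≠ v ∧ Γ.m u v = (k : ℕ∞) ∧
        r = altWord u v k * (altWord v u k)⁻¹ }

/-- The Artin group of a labelled graph. -/
abbrev ArtinGroup (Γ : LabelledGraph V) : Type _ := PresentedGroup Γ.artinRels

/-- The standard generators of an Artin group. -/
def σ (Γ : LabelledGraph V) (v : V) : Γ.ArtinGroup := PresentedGroup.of v

/-- The special subgroup of the Artin group generated by `{σ v : v ∈ K}`. -/
def specialSubgroup (Γ : LabelledGraph V) (K : Set V) : Subgroup Γ.ArtinGroup :=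
  Subgroup.closure (Γ.σ '' K)

/-- A cone point of `Γ`: a vertex `t` with `m t v < ∞` for every `v ≠ t`. -/
def IsConePoint (Γ : LabelledGraph V) (t : V) : Prop :=
  ∀ v : V, v ≠ t → Γ.m t v ≠ ⊤

/-- The induced labelled subgraph on a subset `K` of the vertices. -/
def induce (Γ : LabelledGraph V) (K : Set V) : LabelledGraph K where
  m u v := Γ.m u v
  symm u v := Γ.symm u v
  two_le u v h := Γ.two_le u v (fun e => h (Subtype.ext e))

/-- `Γ` is irreducible if its vertex set admits no partition into two nonempty sets
with all labels between the two parts equal to `2`. -/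
def Irreducible (Γ : LabelledGraph V) : Prop :=
  ¬ ∃ V₁ V₂ : Set V, V₁.Nonempty ∧ V₂.Nonempty ∧ Disjoint V₁ V₂ ∧ V₁ ∪ V₂ = Set.univ ∧
      ∀ u ∈ V₁, ∀ v ∈ V₂, Γ.m u v = 2

/-- The square relations `σ_v² = 1` defining the Coxeter quotient. -/
def squareRels (V : Type*) : Set (FreeGroup V) :=
  Set.range fun v : V => FreeGroup.of v * FreeGroup.of v

/-- The Coxeter group of a labelled graph: the quotient of the Artin group obtained
by adding the relations `σ_v² = 1`. -/
abbrev CoxeterGroupOf (Γ : LabelledGraph V) : Type _ :=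
  PresentedGroup (Γ.artinRels ∪ squareRels V)

/-- `Γ` is spherical if its Coxeter group is finite. -/
def Spherical (Γ : LabelledGraph V) : Prop := Finite Γ.CoxeterGroupOf

/-- The natural surjection `θ` from the Artin group to the Coxeter group. -/
def artinToCoxeter (Γ : LabelledGraph V) : Γ.ArtinGroup →* Γ.CoxeterGroupOf :=
  QuotientGroup.map _ _ (MonoidHom.id _)
    (by
      intro x hx
      simpa using Subgroup.normalClosure_mono (Set.subset_union_left (t := squareRels V)) hx)

/-- The pure Artin group: the kernel of the natural surjection to the Coxeter group. -/
def pureArtinGroup (Γ : LabelledGraph V) : Subgroup Γ.ArtinGroup :=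
  (artinToCoxeter Γ).ker

/-- `P : Fin n → Set V` is a decomposition of `Γ` as a `2`-labelled join of
irreducible induced subgraphs. -/
def IsIrredDecomp (Γ : LabelledGraph V) (n : ℕ) (P : Fin n → Set V) : Prop :=
  (∀ i, (P i).Nonempty) ∧
  (⋃ i, P i) = Set.univ ∧
  (∀ i j, i ≠ j → Disjoint (P i) (P j)) ∧
  (∀ i j, i ≠ j → ∀ u ∈ P i, ∀ v ∈ P j, Γ.m u v = 2) ∧
  (∀ i, (Γ.induce (P i)).Irreducible)

/-- `Γ` satisfies the Center Conjecture if for the (finest) decomposition of `Γ` as a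
`2`-labelled join of irreducible induced subgraphs `Γ₁, …, Γₙ`, the center of the Artin
group `A_Γ` is free abelian of rank the number of spherical factors `Γᵢ`. -/
def SatisfiesCenterConjecture (Γ : LabelledGraph V) : Prop :=
  ∀ (n : ℕ) (P : Fin n → Set V), Γ.IsIrredDecomp n P →
    Nonempty ((Subgroup.center Γ.ArtinGroup) ≃*
      Multiplicative (Fin (Nat.card {i : Fin n // (Γ.induce (P i)).Spherical}) → ℤ))

/-- A monoid hom applied to an alternating product. -/
theorem map_altProd {G H : Type*} [Monoid G] [Monoid H] (φ : G →* H) (x y : G) (n : ℕ) :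
    φ (altProd x y n) = altProd (φ x) (φ y) n := by
  induction n generalizing x y with
  | zero => simp [altProd]
  | succ n ih => simp [altProd, ih]

/-- The homomorphism between Artin groups induced by a label-preserving injection of
labelled graphs, sending generators to generators. -/
def mapHom (Γ : LabelledGraph V) (Δ : LabelledGraph W) (f : V → W)
    (hf : ∀ u v : V, u ≠ v → f u ≠ f v)
    (hm : ∀ u v : V, Γ.m u v = Δ.m (f u) (f v)) :
    Γ.ArtinGroup →* Δ.ArtinGroup :=
  PresentedGroup.toGroup (f := fun v => Δ.σ (f v))
    (by
      rintro r ⟨u, v, k, huv, hk, rfl⟩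
      have key : ∀ (a b : V),
          FreeGroup.lift (fun v => Δ.σ (f v)) (altWord a b k)
            = PresentedGroup.mk Δ.artinRels (altWord (f a) (f b) k) := by
        intro a b
        rw [altWord, map_altProd, altWord, map_altProd]
        simp [σ, PresentedGroup.of]
      rw [map_mul, map_inv, key, key, ← map_inv, ← map_mul]
      refine (QuotientGroup.eq_one_iff _).mpr (Subgroup.subset_normalClosure ?_)
      exact ⟨f u, f v, k, hf u v huv, (hm u v) ▸ hk, rfl⟩)

@[simp]
theorem mapHom_σ (Γ : LabelledGraph V) (Δ : LabelledGraph W) (f : V → W)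
    (hf : ∀ u v : V, u ≠ v → f u ≠ f v)
    (hm : ∀ u v : V, Γ.m u v = Δ.m (f u) (f v)) (v : V) :
    mapHom Γ Δ f hf hm (Γ.σ v) = Δ.σ (f v) :=
  PresentedGroup.toGroup.of _

/-- The homomorphism between the Artin groups of induced subgraphs coming from an
inclusion `K' ⊆ K`. -/
def induceHom (Γ : LabelledGraph V) {K' K : Set V} (h : K' ⊆ K) :
    (Γ.induce K').ArtinGroup →* (Γ.induce K).ArtinGroup :=
  mapHom _ _ (Set.inclusion h)
    (fun _ _ huv e => huv (Set.inclusion_injective h e))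
    (fun _ _ => rfl)

/-- The homomorphism from the Artin group of an induced subgraph to the ambient
Artin group. -/
def inclHom (Γ : LabelledGraph V) (K : Set V) :
    (Γ.induce K).ArtinGroup →* Γ.ArtinGroup :=
  mapHom _ _ Subtype.val
    (fun _ _ huv e => huv (Subtype.ext e))
    (fun _ _ => rfl)

end LabelledGraph

namespace LabelledGraph

section Alternating

variable {G : Type*} [Monoid G]

/-- The alternating product `⋯ * x * y * x` with `n` terms. -/
def revAltProd (x y : G) : ℕ → G
  | 0 => 1
  | n + 1 => revAltProd y x n * x

/-- The `n`-th letter (counted from `0`) of the alternating sequence `x, y, x, ⋯`. -/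
def altLetter {α : Type*} (x y : α) : ℕ → α
  | 0 => x
  | n + 1 => altLetter y x n

theorem altLetter_cases {α : Type*} (x y : α) (n : ℕ) :
    altLetter x y n = x ∧ altLetter x y (n + 1) = y ∨
      altLetter x y n = y ∧ altLetter x y (n + 1) = x := by
  induction n generalizing x y with
  | zero => exact Or.inl ⟨rfl, rfl⟩
  | succ n ih => exact (ih y x).symm

theorem altLetter_ne {α : Type*} {x y : α} (h : x ≠ y) (n : ℕ) :
    altLetter x y n ≠ altLetter x y (n + 1) := by
  rcases altLetter_cases x y n with ⟨h₁, h₂⟩ | ⟨h₁, h₂⟩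
  · rwa [h₁, h₂]
  · rw [h₁, h₂]; exact h.symm

theorem map_altLetter {α β : Type*} (f : α → β) (x y : α) (n : ℕ) :
    f (altLetter x y n) = altLetter (f x) (f y) n := by
  induction n generalizing x y with
  | zero => rfl
  | succ n ih => exact ih y x

theorem altLetter_two_mul_add_one {α : Type*} (x y : α) (n : ℕ) :
    altLetter x y (2 * n + 1) = y := by
  induction n with
  | zero => rfl
  | succ n ih => exact ih

theorem altProd_succ' (x y : G) (n : ℕ) :
    altProd x y (n + 1) = altProd x y n * altLetter x y n := by
  induction n generalizing x y with
  | zero => simp [altProd, altLetter]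
  | succ n ih => rw [altProd, ih y x, ← mul_assoc]; rfl

theorem revAltProd_eq (x y : G) (n : ℕ) :
    revAltProd x y n = altProd x y n ∧ revAltProd y x n = altProd y x n ∨
      revAltProd x y n = altProd y x n ∧ revAltProd y x n = altProd x y n := by
  have key : revAltProd x y n = altProd x y n ∧ revAltProd y x n = altProd y x n ∧
      altLetter x y n = y ∧ altLetter y x n = x ∨
      revAltProd x y n = altProd y x n ∧ revAltProd y x n = altProd x y n ∧
      altLetter x y n = x ∧ altLetter y x n = y := by
    induction n with
    | zero => exact Or.inr ⟨rfl, rfl, rfl, rfl⟩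
    | succ n ih =>
      rcases ih with ⟨h₁, h₂, h₃, h₄⟩ | ⟨h₁, h₂, h₃, h₄⟩
      · refine Or.inr ⟨?_, ?_, h₄, h₃⟩
        · rw [altProd_succ', revAltProd, h₂, h₄]
        · rw [altProd_succ', revAltProd, h₁, h₃]
      · refine Or.inl ⟨?_, ?_, h₄, h₃⟩
        · rw [altProd_succ', revAltProd, h₂, h₃]
        · rw [altProd_succ', revAltProd, h₁, h₄]
  tauto

theorem revAltProd_comm_iff (x y : G) (n : ℕ) :
    revAltProd x y n = revAltProd y x n ↔ altProd x y n = altProd y x n := by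
  rcases revAltProd_eq x y n with ⟨h₁, h₂⟩ | ⟨h₁, h₂⟩
  · rw [h₁, h₂]
  · rw [h₁, h₂, eq_comm]

theorem revAltProd_add (x y : G) (a b : ℕ) :
    revAltProd x y (a + b) =
      revAltProd (altLetter x y a) (altLetter x y (a + 1)) b * revAltProd x y a := by
  induction a generalizing x y with
  | zero => simp [revAltProd, altLetter]
  | succ a ih =>
    rw [Nat.add_right_comm, revAltProd, ih y x, revAltProd, mul_assoc]
    rfl

theorem altProd_mul_revAltProd {x y : G} (hx : x * x = 1) (hy : y * y = 1) (n : ℕ) :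
    altProd x y n * revAltProd x y n = 1 := by
  induction n generalizing x y with
  | zero => simp [revAltProd, altProd]
  | succ n ih =>
    rw [revAltProd, altProd, mul_assoc, ← mul_assoc _ _ x, ih hy hx, one_mul, hx]

end Alternating

end LabelledGraph

namespace CoxeterMatrix

open Finsupp LabelledGraph

variable {V : Type*} (M : CoxeterMatrix V)

/-- The entries `-cos (π / M u v)` of the canonical bilinear form (`-1` when `M u v = 0`). -/
noncomputable def formEntry (u v : V) : ℝ := -Real.cos (Real.pi / M u v)

/-- The canonical bilinear form of a Coxeter matrix. -/
noncomputable def form : (V →₀ ℝ) →ₗ[ℝ] (V →₀ ℝ) →ₗ[ℝ] ℝ :=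
  linearCombination ℝ fun u => linearCombination ℝ fun v => M.formEntry u v

/-- The reflection of the geometric representation attached to a simple root. -/
noncomputable def simpleRefl (u : V) : Module.End ℝ (V →₀ ℝ) :=
  LinearMap.id - (2 : ℝ) • (M.form (single u 1)).smulRight (single u 1)

theorem formEntry_comm (u v : V) : M.formEntry u v = M.formEntry v u := by
  rw [formEntry, formEntry, M.symmetric]

theorem formEntry_self (u : V) : M.formEntry u u = 1 := by simp [formEntry]

theorem form_single (u v : V) : M.form (single u 1) (single v 1) = M.formEntry u v := by
  simp [form]

theorem form_comm (x y : V →₀ ℝ) : M.form x y = M.form y x := by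
  have h : M.form = M.form.flip := by
    ext u v
    simp [form, M.formEntry_comm u v]
  rw [← LinearMap.flip_apply, ← h]

theorem simpleRefl_apply (u : V) (y : V →₀ ℝ) :
    M.simpleRefl u y = y - (2 * M.form (single u 1) y) • single u 1 := by
  simp [simpleRefl, mul_smul]

theorem simpleRefl_apply_of_ne {u v : V} (h : v ≠ u) (y : V →₀ ℝ) :
    M.simpleRefl u y v = y v := by
  simp [simpleRefl_apply, h.symm]

theorem simpleRefl_single (u : V) : M.simpleRefl u (single u 1) = -single u 1 := by
  rw [simpleRefl_apply, form_single, formEntry_self]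
  module

theorem form_simpleRefl (u : V) (x y : V →₀ ℝ) :
    M.form (M.simpleRefl u x) (M.simpleRefl u y) = M.form x y := by
  simp only [simpleRefl_apply, map_sub, map_smul, LinearMap.sub_apply, LinearMap.smul_apply,
    form_single, formEntry_self, smul_eq_mul]
  rw [M.form_comm x (single u 1)]
  ring

theorem simpleRefl_mul_self (u : V) : M.simpleRefl u * M.simpleRefl u = 1 := by
  ext1 v
  ext1
  simp only [LinearMap.comp_apply, Module.End.mul_apply, Module.End.one_apply, lsingle_apply]
  rw [M.simpleRefl_apply u (single v 1), map_sub, map_smul, simpleRefl_single, simpleRefl_apply]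
  module

theorem two_le_of_ne {u v : V} (h : u ≠ v) (h₀ : M u v ≠ 0) : 2 ≤ M u v := by
  have := M.off_diagonal u v h
  have : M u v ≠ 1 := this
  omega

/-- The numbers `sin (n π / M u v) / sin (π / M u v)` (or `n`, when `M u v = 0`): the coordinates of
the roots in the plane spanned by two simple roots. -/
noncomputable def rootCoeff (u v : V) (n : ℕ) : ℝ :=
  if M u v = 0 then n else Real.sin (n * (Real.pi / M u v)) / Real.sin (Real.pi / M u v)

theorem rootCoeff_comm (u v : V) : M.rootCoeff u v = M.rootCoeff v u := by
  funext n
  rw [rootCoeff, rootCoeff, M.symmetric]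

theorem sin_pos {u v : V} (h : u ≠ v) (h₀ : M u v ≠ 0) : 0 < Real.sin (Real.pi / M u v) := by
  have h₂ : (2 : ℝ) ≤ M u v := by exact_mod_cast M.two_le_of_ne h h₀
  apply Real.sin_pos_of_pos_of_lt_pi
  · positivity
  · exact div_lt_self Real.pi_pos (by linarith)

theorem rootCoeff_zero (u v : V) : M.rootCoeff u v 0 = 0 := by simp [rootCoeff]

theorem rootCoeff_one {u v : V} (h : u ≠ v) : M.rootCoeff u v 1 = 1 := by
  by_cases h₀ : M u v = 0
  · simp [rootCoeff, h₀]
  · simp [rootCoeff, h₀, (M.sin_pos h h₀).ne']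

theorem rootCoeff_add_two (u v : V) (n : ℕ) :
    M.rootCoeff u v (n + 2) = -2 * M.formEntry u v * M.rootCoeff u v (n + 1) -
      M.rootCoeff u v n := by
  by_cases h₀ : M u v = 0
  · simp [rootCoeff, h₀, formEntry]; ring
  · simp only [rootCoeff, h₀, if_false, formEntry]
    set θ := Real.pi / M u v
    have e₁ : ((n + 2 : ℕ) : ℝ) * θ = (n + 1 : ℕ) * θ + θ := by push_cast; ring
    have e₂ : (n : ℝ) * θ = (n + 1 : ℕ) * θ - θ := by push_cast; ring
    rw [e₁, e₂, Real.sin_add, Real.sin_sub]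
    ring

theorem rootCoeff_pos {u v : V} (h : u ≠ v) {n : ℕ} (hn : 0 < n) (hM : M u v ≠ 0 → n < M u v) :
    0 < M.rootCoeff u v n := by
  by_cases h₀ : M u v = 0
  · simpa [rootCoeff, h₀]
  · simp only [rootCoeff, h₀, if_false]
    refine div_pos (Real.sin_pos_of_pos_of_lt_pi ?_ ?_) (M.sin_pos h h₀)
    · have : (0 : ℝ) < n := by exact_mod_cast hn
      have : (0 : ℝ) < M u v := by exact_mod_cast Nat.pos_of_ne_zero h₀
      positivity
    · have h₁ : (0 : ℝ) < M u v := by exact_mod_cast Nat.pos_of_ne_zero h₀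
      have h₂ : (n : ℝ) < M u v := by exact_mod_cast hM h₀
      rw [← mul_div_assoc, div_lt_iff₀ h₁, mul_comm]
      exact mul_lt_mul_of_pos_left h₂ Real.pi_pos

theorem rootCoeff_nonneg {u v : V} (h : u ≠ v) {n : ℕ} (hM : M u v ≠ 0 → n ≤ M u v) :
    0 ≤ M.rootCoeff u v n := by
  by_cases hn : n = 0
  · rw [hn, rootCoeff_zero]
  by_cases h₁ : M u v ≠ 0 ∧ n = M u v
  · have h₀ : (M u v : ℝ) ≠ 0 := by exact_mod_cast h₁.1
    rw [h₁.2, rootCoeff, if_neg h₁.1, mul_div_cancel₀ _ h₀]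
    simp
  · refine (M.rootCoeff_pos h (by omega) fun h₀ => ?_).le
    have := hM h₀
    by_contra h₂
    exact h₁ ⟨h₀, by omega⟩

theorem rootCoeff_sub {u v : V} (h₀ : M u v ≠ 0) {n : ℕ} (hn : n ≤ M u v) :
    M.rootCoeff u v (M u v - n) = M.rootCoeff u v n := by
  have h₁ : (M u v : ℝ) ≠ 0 := by exact_mod_cast h₀
  simp only [rootCoeff, h₀, if_false, Nat.cast_sub hn, sub_mul]
  rw [mul_div_cancel₀ _ h₁, Real.sin_pi_sub]

theorem rootCoeff_add_two_mul {u v : V} (h₀ : M u v ≠ 0) (n : ℕ) :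
    M.rootCoeff u v (n + 2 * M u v) = M.rootCoeff u v n := by
  have h₁ : (M u v : ℝ) ≠ 0 := by exact_mod_cast h₀
  simp only [rootCoeff, h₀, if_false]
  congr 1
  rw [← Real.sin_add_two_pi (n * (Real.pi / M u v))]
  congr 1
  push_cast
  field_simp

/-- The roots in the plane spanned by two simple roots `u`, `v`, starting with `u`. -/
noncomputable def planeRoot (u v : V) (n : ℕ) : V →₀ ℝ :=
  M.rootCoeff u v (n + 1) • single u 1 + M.rootCoeff u v n • single v 1

theorem planeRoot_zero {u v : V} (h : u ≠ v) : M.planeRoot u v 0 = single u 1 := by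
  simp [planeRoot, rootCoeff_zero, M.rootCoeff_one h]

theorem simpleRefl_planeRoot (u v : V) (n : ℕ) :
    M.simpleRefl u (M.planeRoot v u n) = M.planeRoot u v (n + 1) := by
  rw [simpleRefl_apply, planeRoot, planeRoot, map_add, map_smul, map_smul, form_single,
    form_single, formEntry_self, M.rootCoeff_comm v u, rootCoeff_add_two]
  simp only [smul_eq_mul]
  module

theorem planeRoot_sub {u v : V} (h₀ : M u v ≠ 0) {n : ℕ} (hn : n < M u v) :
    M.planeRoot u v (M u v - 1 - n) = M.planeRoot v u n := by
  have e : M u v - 1 - n + 1 = M u v - n := by omega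
  have e' : M u v - 1 - n = M u v - (n + 1) := by omega
  rw [planeRoot, planeRoot, e, e', M.rootCoeff_sub h₀ hn.le, M.rootCoeff_sub h₀ hn,
    M.rootCoeff_comm v u, add_comm]

theorem mul_pow_planeRoot (u v : V) (n i : ℕ) :
    ((M.simpleRefl u * M.simpleRefl v) ^ n) (M.planeRoot u v i) =
      M.planeRoot u v (i + 2 * n) := by
  induction n with
  | zero => simp
  | succ n ih =>
    rw [pow_succ', Module.End.mul_apply, ih, Module.End.mul_apply, simpleRefl_planeRoot,
      simpleRefl_planeRoot]
    rfl

theorem isLiftable_simpleRefl : M.IsLiftable M.simpleRefl := by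
  intro u v
  by_cases huv : u = v
  · subst huv
    rw [simpleRefl_mul_self, one_pow]
  by_cases h₀ : M u v = 0
  · rw [h₀, pow_zero]
  set T := (M.simpleRefl u * M.simpleRefl v) ^ M u v with hT
  have hroot (i : ℕ) : T (M.planeRoot u v i) = M.planeRoot u v i := by
    rw [hT, mul_pow_planeRoot]
    simp only [planeRoot, Nat.add_right_comm i _ 1, M.rootCoeff_add_two_mul h₀]
  have hu : T (single u 1) = single u 1 := by
    rw [← M.planeRoot_zero huv, hroot]
  have hv : T (single v 1) = single v 1 := by
    have h := hroot 1
    rw [planeRoot, map_add, map_smul, map_smul, hu, M.rootCoeff_one huv] at h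
    simpa using h
  have hfix (y : V →₀ ℝ) (h₁ : M.form (single u 1) y = 0) (h₂ : M.form (single v 1) y = 0) :
      T y = y := by
    have h : (M.simpleRefl u * M.simpleRefl v) y = y := by
      simp [simpleRefl_apply, h₁, h₂]
    rw [hT]
    generalize M u v = n
    induction n with
    | zero => rfl
    | succ n ih => rw [pow_succ, Module.End.mul_apply, h, ih]
  ext1 w
  ext1
  simp only [LinearMap.comp_apply, lsingle_apply, Module.End.one_apply]
  set y : V →₀ ℝ := single w 1
  set c := M.formEntry u v with hc
  have hdet : 1 - c ^ 2 ≠ 0 := by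
    have := M.sin_pos huv h₀
    have h := Real.sin_sq_add_cos_sq (Real.pi / M u v)
    have : 1 - c ^ 2 = Real.sin (Real.pi / M u v) ^ 2 := by
      rw [hc, formEntry]; linarith [neg_sq (Real.cos (Real.pi / M u v))]
    rw [this]; positivity
  set p := M.form (single u 1) y with hp
  set q := M.form (single v 1) y with hq
  set a := (p - c * q) / (1 - c ^ 2) with ha
  set b := (q - c * p) / (1 - c ^ 2) with hb
  have hz := hfix (y - a • single u 1 - b • single v 1)
    (by
      simp only [map_sub, map_smul, form_single, formEntry_self, smul_eq_mul, ← hp, ← hc, ha, hb]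
      field_simp; ring)
    (by
      simp only [map_sub, map_smul, form_single, formEntry_self, smul_eq_mul, ← hq,
        M.formEntry_comm v u, ← hc, ha, hb]
      field_simp; ring)
  rw [map_sub, map_sub, map_smul, map_smul, hu, hv] at hz
  simpa using hz

/-- The geometric representation of the Coxeter group of a Coxeter matrix. -/
noncomputable def geomRep : M.Group →* Module.End ℝ (V →₀ ℝ) :=
  M.toCoxeterSystem.lift ⟨M.simpleRefl, M.isLiftable_simpleRefl⟩

@[simp]
theorem geomRep_simple (u : V) : M.geomRep (M.simple u) = M.simpleRefl u := by
  rw [← M.toCoxeterSystem_simple]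
  exact M.toCoxeterSystem.lift_apply_simple _ u

theorem simple_mul_self (u : V) : M.simple u * M.simple u = 1 := by
  rw [← M.toCoxeterSystem_simple]
  exact M.toCoxeterSystem.simple_mul_simple_self u

theorem simple_mul_simple_mul (u : V) (w : M.Group) : M.simple u * (M.simple u * w) = w := by
  rw [← mul_assoc, simple_mul_self, one_mul]

theorem form_geomRep (w : M.Group) (x y : V →₀ ℝ) :
    M.form (M.geomRep w x) (M.geomRep w y) = M.form x y := by
  induction w using M.toCoxeterSystem.simple_induction generalizing x y with
  | simple u => rw [M.toCoxeterSystem_simple, geomRep_simple, form_simpleRefl]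
  | one => simp
  | mul w₁ w₂ h₁ h₂ => rw [map_mul, Module.End.mul_apply, Module.End.mul_apply, h₁, h₂]

theorem geomRep_injective (w : M.Group) : Function.Injective (M.geomRep w) := by
  intro x y h
  have := congrArg (M.geomRep w⁻¹) h
  simpa only [← Module.End.mul_apply, ← map_mul, inv_mul_cancel, map_one,
    Module.End.one_apply] using this

theorem revAltProd_simple_comm (u v : V) :
    revAltProd (M.simple u) (M.simple v) (M u v) =
      revAltProd (M.simple v) (M.simple u) (M u v) := by
  have h (u v : V) (n : ℕ) : M.toCoxeterSystem.wordProd (CoxeterSystem.alternatingWord u v n) =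
      revAltProd (M.simple v) (M.simple u) n := by
    induction n generalizing u v with
    | zero => simp [CoxeterSystem.alternatingWord, revAltProd]
    | succ n ih =>
      rw [CoxeterSystem.alternatingWord, CoxeterSystem.wordProd_concat, ih, revAltProd,
        M.toCoxeterSystem_simple]
  have := M.toCoxeterSystem.wordProd_braidWord_eq u v
  rw [h, h, M.symmetric v u] at this
  exact this.symm

theorem geomRep_revAltProd_planeRoot (u v : V) (n i : ℕ) :
    M.geomRep (revAltProd (M.simple v) (M.simple u) n) (M.planeRoot u v i) =
        M.planeRoot u v (i + n) ∨
      M.geomRep (revAltProd (M.simple v) (M.simple u) n) (M.planeRoot u v i) =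
        M.planeRoot v u (i + n) := by
  induction n generalizing u v i with
  | zero => exact Or.inl (by simp [revAltProd])
  | succ n ih =>
    rw [revAltProd, map_mul, Module.End.mul_apply, geomRep_simple, simpleRefl_planeRoot,
      ← add_assoc, add_right_comm]
    exact (ih v u (i + 1)).symm

end CoxeterMatrix

namespace CoxeterMatrix

open Finsupp LabelledGraph

variable {V : Type*} (M : CoxeterMatrix V)

local notation "ℓ" => M.toCoxeterSystem.length

theorem length_simple_le (u : V) : ℓ (M.simple u) ≤ 1 := by
  rw [← M.toCoxeterSystem_simple, CoxeterSystem.length_simple]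

theorem length_revAltProd_le (u v : V) (n : ℕ) :
    ℓ (revAltProd (M.simple u) (M.simple v) n) ≤ n := by
  induction n generalizing u v with
  | zero => simp [revAltProd]
  | succ n ih =>
    rw [revAltProd]
    refine (M.toCoxeterSystem.length_mul_le _ _).trans ?_
    have := M.length_simple_le u
    have := ih v u
    omega

theorem length_mul_simple (w : M.Group) (u : V) :
    ℓ (w * M.simple u) = ℓ w + 1 ∨ ℓ (w * M.simple u) + 1 = ℓ w := by
  rw [← M.toCoxeterSystem_simple]
  exact M.toCoxeterSystem.length_mul_simple w u

theorem geomRep_single_nonneg {w : M.Group} {u : V} (h : ℓ w ≤ ℓ (w * M.simple u)) :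
    0 ≤ M.geomRep w (single u 1) := by
  induction hn : ℓ w using Nat.strong_induction_on generalizing w u with
  | _ N ih =>
  subst hn
  by_cases hw : w = 1
  · subst hw
    simp
  obtain ⟨r, hr⟩ := M.toCoxeterSystem.exists_rightDescent_of_ne_one hw
  rw [CoxeterSystem.IsRightDescent, M.toCoxeterSystem_simple] at hr
  have hur : u ≠ r := by
    rintro rfl
    omega
  let v (n : ℕ) : M.Group := w * altProd (M.simple r) (M.simple u) n
  have hvsucc (n : ℕ) : v (n + 1) = v n * M.simple (altLetter r u n) := by
    simp only [v, altProd_succ', map_altLetter M.simple, mul_assoc]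
  have hv (n : ℕ) : v n * revAltProd (M.simple r) (M.simple u) n = w := by
    simp only [v]
    rw [mul_assoc, altProd_mul_revAltProd (M.simple_mul_self r) (M.simple_mul_self u), mul_one]
  have hex : ∃ n, ℓ (v (n + 1)) + (n + 1) ≠ ℓ w := ⟨ℓ w, by omega⟩
  classical
  let n := Nat.find hex
  have hlen (i : ℕ) (hi : i ≤ n) : ℓ (v i) + i = ℓ w := by
    cases i with
    | zero => simp [v, altProd]
    | succ i => exact not_not.1 (Nat.find_min hex hi)
  have hn₀ : n ≠ 0 := by
    intro h₀
    have h₁ := Nat.find_spec hex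
    rw [show Nat.find hex = 0 from h₀] at h₁
    have h₂ : v 1 = w * M.simple r := by simp [v, altProd]
    rcases M.length_mul_simple w r with h₃ | h₃
    · omega
    · rw [zero_add, h₂] at h₁
      exact h₁ h₃
  have hnM (h₀ : M u r ≠ 0) : n < M u r := by
    by_contra! hle
    have h₁ := hlen _ hle
    obtain ⟨k, hk⟩ := Nat.exists_eq_succ_of_ne_zero h₀
    have h₂ : w * M.simple u = v (M u r) * revAltProd (M.simple r) (M.simple u) k := by
      rw [← hv (M u r), ← M.revAltProd_simple_comm, hk, revAltProd]
      simp only [mul_assoc, simple_mul_self, mul_one]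
    have h₃ := M.toCoxeterSystem.length_mul_le (v (M u r))
      (revAltProd (M.simple r) (M.simple u) k)
    rw [← h₂] at h₃
    have h₄ := M.length_revAltProd_le r u k
    omega
  obtain ⟨k, hk⟩ := Nat.exists_eq_succ_of_ne_zero hn₀
  have hln := hlen n le_rfl
  have hlt : ℓ (v n) < ℓ w := by omega
  have hnext : 0 ≤ M.geomRep (v n) (single (altLetter r u n) 1) := by
    refine ih _ hlt ?_ rfl
    have h₁ := Nat.find_spec hex
    change ℓ (v (n + 1)) + (n + 1) ≠ ℓ w at h₁
    rw [hvsucc] at h₁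
    rcases M.length_mul_simple (v n) (altLetter r u n) with h₂ | h₂ <;> omega
  have hprev : 0 ≤ M.geomRep (v n) (single (altLetter r u k) 1) := by
    refine ih _ hlt ?_ rfl
    have h₁ : v n * M.simple (altLetter r u k) = v k := by
      rw [hk, Nat.succ_eq_add_one, hvsucc, mul_assoc, M.simple_mul_self, mul_one]
    have h₂ := hlen k (by omega)
    rw [h₁]
    omega
  have hboth : 0 ≤ M.geomRep (v n) (single r 1) ∧ 0 ≤ M.geomRep (v n) (single u 1) := by
    rw [hk, Nat.succ_eq_add_one] at hnext
    rcases altLetter_cases r u k with ⟨h₁, h₂⟩ | ⟨h₁, h₂⟩ <;> rw [h₁] at hprev <;>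
      rw [h₂] at hnext
    · exact ⟨hprev, hk ▸ hnext⟩
    · exact ⟨hk ▸ hnext, hprev⟩
  have hc₁ := M.rootCoeff_nonneg hur (n := n + 1) hnM
  have hc₂ := M.rootCoeff_nonneg hur (n := n) fun h₀ => (hnM h₀).le
  rw [← hv n, map_mul, Module.End.mul_apply, ← M.planeRoot_zero hur]
  rcases M.geomRep_revAltProd_planeRoot u r n 0 with h₁ | h₁ <;>
    rw [h₁, zero_add, planeRoot, map_add, map_smul, map_smul]
  · exact add_nonneg (smul_nonneg hc₁ hboth.2) (smul_nonneg hc₂ hboth.1)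
  · rw [M.rootCoeff_comm r u]
    exact add_nonneg (smul_nonneg hc₁ hboth.1) (smul_nonneg hc₂ hboth.2)

theorem geomRep_single_nonneg_or_nonpos (w : M.Group) (u : V) :
    0 ≤ M.geomRep w (single u 1) ∨ M.geomRep w (single u 1) ≤ 0 := by
  rcases M.length_mul_simple w u with h | h
  · exact Or.inl (M.geomRep_single_nonneg (by omega))
  · right
    have h₁ : 0 ≤ M.geomRep (w * M.simple u) (single u 1) := by
      refine M.geomRep_single_nonneg ?_
      rw [mul_assoc, simple_mul_self, mul_one]
      omega
    rw [map_mul, Module.End.mul_apply, geomRep_simple, simpleRefl_single, map_neg] at h₁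
    exact neg_nonneg.1 h₁

/-- A positive root other than the simple root `single u 1` remains positive under the simple
reflection attached to `u`. -/
theorem geomRep_simple_mul_single_nonneg {w : M.Group} {u v : V}
    (h : 0 ≤ M.geomRep w (single v 1)) (hne : M.geomRep w (single v 1) ≠ single u 1) :
    0 ≤ M.geomRep (M.simple u * w) (single v 1) := by
  refine (M.geomRep_single_nonneg_or_nonpos _ _).resolve_right fun hneg => hne ?_
  rw [map_mul, Module.End.mul_apply, geomRep_simple] at hneg
  set x := M.geomRep w (single v 1) with hx
  have h₁ : x = x u • single u 1 := by
    ext r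
    by_cases hr : r = u
    · simp [hr]
    · have h₂ := hneg r
      rw [M.simpleRefl_apply_of_ne hr] at h₂
      have h₃ : x r = 0 := le_antisymm h₂ (h r)
      simp [h₃, Ne.symm hr]
  have h₂ : M.form x x = 1 := by
    rw [hx, form_geomRep, form_single, formEntry_self]
  have h₃ : x u * x u = 1 := by
    rw [h₁, map_smul, LinearMap.map_smul₂, form_single, formEntry_self] at h₂
    simpa using h₂
  have h₄ : 0 ≤ x u := h u
  have h₅ : x u = 1 := by nlinarith
  rw [h₁, h₅, one_smul]

theorem not_geomRep_simple_mul_eq {w : M.Group} {u v : V}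
    (h : 0 ≤ M.geomRep w (single v 1)) :
    M.geomRep (M.simple u * w) (single v 1) ≠ single u 1 := by
  intro he
  have h₁ := congrArg (M.simpleRefl u) he
  rw [map_mul, Module.End.mul_apply, geomRep_simple, ← Module.End.mul_apply, simpleRefl_mul_self,
    Module.End.one_apply, simpleRefl_single] at h₁
  have h₂ := h u
  rw [h₁] at h₂
  norm_num at h₂

end CoxeterMatrix

namespace LabelledGraph

open Finsupp

variable {V : Type*} (Γ : LabelledGraph V) (K : Set V)

open Classical in
/-- The Coxeter matrix of a labelled graph, with `0` standing for the label `∞`. -/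
noncomputable def coxeterMatrix : CoxeterMatrix V where
  M := Matrix.of fun u v => if u = v then 1 else (Γ.m u v).toNat
  isSymm := by
    ext u v
    simp [eq_comm, Γ.symm u v]
  diagonal u := by simp
  off_diagonal u v huv := by
    have h := Γ.two_le u v huv
    simp only [Matrix.of_apply, huv, if_false]
    intro h₁
    cases hm : Γ.m u v with
    | top => simp [hm] at h₁
    | coe n =>
      rw [hm] at h h₁
      rw [ENat.toNat_natCast] at h₁
      subst h₁
      norm_num at h

theorem coxeterMatrix_apply {u v : V} (h : u ≠ v) : Γ.coxeterMatrix u v = (Γ.m u v).toNat := by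
  simp [coxeterMatrix, h]

theorem coxeterMatrix_ne_zero {u v : V} {n : ℕ} (h : u ≠ v) (hn : Γ.m u v = n) :
    Γ.coxeterMatrix u v ≠ 0 := by
  have h₂ := Γ.two_le u v h
  rw [Γ.coxeterMatrix_apply h, hn, ENat.toNat_natCast]
  rintro rfl
  rw [hn] at h₂
  norm_num at h₂

theorem altProd_σ_comm {u v : V} {n : ℕ} (h : u ≠ v) (hn : Γ.m u v = n) :
    altProd (Γ.σ u) (Γ.σ v) n = altProd (Γ.σ v) (Γ.σ u) n := by
  have h₁ := PresentedGroup.mk_eq_mk_of_mul_inv_mem (rels := Γ.artinRels)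
    (show altWord u v n * (altWord v u n)⁻¹ ∈ Γ.artinRels from ⟨u, v, n, h, hn, rfl⟩)
  rwa [altWord, altWord, map_altProd, map_altProd] at h₁

/-- The universal property of an Artin group. -/
def liftArtin {G : Type*} [Group G] (f : V → G)
    (hf : ∀ (u v : V) (n : ℕ), u ≠ v → Γ.m u v = n →
      altProd (f u) (f v) n = altProd (f v) (f u) n) :
    Γ.ArtinGroup →* G :=
  PresentedGroup.toGroup (f := f) (by
    rintro r ⟨u, v, n, huv, hn, rfl⟩
    rw [map_mul, map_inv, altWord, altWord, map_altProd, map_altProd]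
    simp [hf u v n huv hn])

@[simp]
theorem liftArtin_σ {G : Type*} [Group G] (f : V → G)
    (hf : ∀ (u v : V) (n : ℕ), u ≠ v → Γ.m u v = n →
      altProd (f u) (f v) n = altProd (f v) (f u) n)
    (v : V) : Γ.liftArtin f hf (Γ.σ v) = f v :=
  PresentedGroup.toGroup.of _

/-- The inverses of the minimal coset representatives of the parabolic subgroup attached to `K`. -/
def chambers : Set Γ.coxeterMatrix.Group :=
  {d | ∀ k ∈ K, 0 ≤ Γ.coxeterMatrix.geomRep d (single k 1)}

/-- The generator `s` fixes the chamber `d`, where it acts as the generator `k ∈ K`. -/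
def IsLoop (d : Γ.coxeterMatrix.Group) (x : V →₀ ℝ) (k : V) : Prop :=
  k ∈ K ∧ Γ.coxeterMatrix.geomRep d (single k 1) = x

variable {Γ K}

theorem IsLoop.unique {d : Γ.coxeterMatrix.Group} {x : V →₀ ℝ} {k k' : V}
    (h : Γ.IsLoop K d x k) (h' : Γ.IsLoop K d x k') : k = k' := by
  have h₁ := Γ.coxeterMatrix.geomRep_injective d (h.2.trans h'.2.symm)
  exact (single_left_inj one_ne_zero).1 h₁

theorem simple_mul_mem_chambers {d : Γ.coxeterMatrix.Group} (hd : d ∈ Γ.chambers K) {s : V}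
    (h : ¬∃ k, Γ.IsLoop K d (single s 1) k) : Γ.coxeterMatrix.simple s * d ∈ Γ.chambers K :=
  fun k hk => Γ.coxeterMatrix.geomRep_simple_mul_single_nonneg (hd k hk) fun he => h ⟨k, hk, he⟩

theorem not_isLoop_simple_mul {d : Γ.coxeterMatrix.Group} (hd : d ∈ Γ.chambers K) (s : V) :
    ¬∃ k, Γ.IsLoop K (Γ.coxeterMatrix.simple s * d) (single s 1) k :=
  fun ⟨k, hk, he⟩ => Γ.coxeterMatrix.not_geomRep_simple_mul_eq (hd k hk) he

open Classical in
/-- One step of the folding of galleries onto the parabolic subgroup attached to `K`. -/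
noncomputable def foldFun (c : V → Γ.ArtinGroup) (s : V) (z : Γ.ArtinGroup × Γ.chambers K) :
    Γ.ArtinGroup × Γ.chambers K :=
  if h : ∃ k, Γ.IsLoop K z.2 (single s 1) k then (c h.choose * z.1, z.2)
  else (z.1, ⟨Γ.coxeterMatrix.simple s * z.2, simple_mul_mem_chambers z.2.2 h⟩)

theorem foldFun_of_isLoop (c : V → Γ.ArtinGroup) {s k : V} {z : Γ.ArtinGroup × Γ.chambers K}
    (h : Γ.IsLoop K z.2 (single s 1) k) : foldFun c s z = (c k * z.1, z.2) := by
  have h' : ∃ k, Γ.IsLoop K z.2 (single s 1) k := ⟨k, h⟩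
  rw [foldFun, dif_pos h', h'.choose_spec.unique h]

theorem foldFun_of_not (c : V → Γ.ArtinGroup) {s : V} {z : Γ.ArtinGroup × Γ.chambers K}
    (h : ¬∃ k, Γ.IsLoop K z.2 (single s 1) k) :
    foldFun c s z = (z.1, ⟨Γ.coxeterMatrix.simple s * z.2, simple_mul_mem_chambers z.2.2 h⟩) := by
  rw [foldFun, dif_neg h]

theorem foldFun_foldFun {c c' : V → Γ.ArtinGroup} (hc : ∀ v, c v * c' v = 1) (s : V)
    (z : Γ.ArtinGroup × Γ.chambers K) : foldFun c s (foldFun c' s z) = z := by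
  by_cases h : ∃ k, Γ.IsLoop K z.2 (single s 1) k
  · obtain ⟨k, hk⟩ := h
    rw [foldFun_of_isLoop c' hk, foldFun_of_isLoop c (z := (c' k * z.1, z.2)) hk, ← mul_assoc, hc,
      one_mul]
  · rw [foldFun_of_not c' h, foldFun_of_not c (z := (_, _)) (not_isLoop_simple_mul z.2.2 s)]
    simp [Γ.coxeterMatrix.simple_mul_simple_mul]

variable (Γ K) in
/-- The permutation through which a standard generator acts on `A_Γ × chambers`. -/
noncomputable def foldPerm (s : V) : Equiv.Perm (Γ.ArtinGroup × Γ.chambers K) where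
  toFun := foldFun Γ.σ s
  invFun := foldFun (fun v => (Γ.σ v)⁻¹) s
  left_inv := foldFun_foldFun (by simp) s
  right_inv := foldFun_foldFun (by simp) s

theorem foldPerm_of_isLoop {s k : V} {z : Γ.ArtinGroup × Γ.chambers K}
    (h : Γ.IsLoop K z.2 (single s 1) k) : Γ.foldPerm K s z = (Γ.σ k * z.1, z.2) :=
  foldFun_of_isLoop _ h

theorem foldPerm_of_not {s : V} {z : Γ.ArtinGroup × Γ.chambers K}
    (h : ¬∃ k, Γ.IsLoop K z.2 (single s 1) k) :
    (Γ.foldPerm K s z).1 = z.1 ∧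
      ((Γ.foldPerm K s z).2 : Γ.coxeterMatrix.Group) = Γ.coxeterMatrix.simple s * z.2 := by
  have h₁ : Γ.foldPerm K s z = _ := foldFun_of_not _ h
  rw [h₁]
  exact ⟨rfl, rfl⟩

theorem isLoop_simple_mul_iff {s r : V} {i : ℕ} {d : Γ.coxeterMatrix.Group} {k : V} :
    Γ.IsLoop K (Γ.coxeterMatrix.simple s * d) (Γ.coxeterMatrix.planeRoot r s i) k ↔
      Γ.IsLoop K d (Γ.coxeterMatrix.planeRoot s r (i + 1)) k := by
  rw [IsLoop, IsLoop, map_mul, Module.End.mul_apply, CoxeterMatrix.geomRep_simple,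
    ← Γ.coxeterMatrix.simpleRefl_planeRoot]
  refine and_congr_right fun _ => ⟨fun h => ?_, fun h => ?_⟩
  · rw [← h, ← Module.End.mul_apply, CoxeterMatrix.simpleRefl_mul_self, Module.End.one_apply]
  · rw [h, ← Module.End.mul_apply, CoxeterMatrix.simpleRefl_mul_self, Module.End.one_apply]

theorem isLoop_revAltProd_iff {s r : V} {a i : ℕ} {d : Γ.coxeterMatrix.Group} {k : V} :
    Γ.IsLoop K (revAltProd (Γ.coxeterMatrix.simple s) (Γ.coxeterMatrix.simple r) a * d)
        (Γ.coxeterMatrix.planeRoot (altLetter s r a) (altLetter s r (a + 1)) i) k ↔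
      Γ.IsLoop K d (Γ.coxeterMatrix.planeRoot s r (i + a)) k := by
  induction a generalizing s r d with
  | zero => simp [revAltProd, altLetter]
  | succ a ih =>
    rw [revAltProd, mul_assoc, ← add_assoc, ← isLoop_simple_mul_iff]
    exact ih

theorem revAltProd_foldPerm_of_not {s r : V} (hsr : s ≠ r) {n : ℕ}
    {z : Γ.ArtinGroup × Γ.chambers K}
    (h : ∀ i < n, ¬∃ k, Γ.IsLoop K z.2 (Γ.coxeterMatrix.planeRoot s r i) k) :
    (revAltProd (Γ.foldPerm K s) (Γ.foldPerm K r) n z).1 = z.1 ∧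
      ((revAltProd (Γ.foldPerm K s) (Γ.foldPerm K r) n z).2 : Γ.coxeterMatrix.Group) =
        revAltProd (Γ.coxeterMatrix.simple s) (Γ.coxeterMatrix.simple r) n * z.2 := by
  induction n generalizing s r z with
  | zero => simp [revAltProd]
  | succ n ih =>
    have h₀ := h 0 n.succ_pos
    rw [Γ.coxeterMatrix.planeRoot_zero hsr] at h₀
    obtain ⟨h₁, h₂⟩ := foldPerm_of_not h₀
    obtain ⟨h₃, h₄⟩ := ih hsr.symm (z := Γ.foldPerm K s z) (by
      intro i hi
      simp only [h₂, isLoop_simple_mul_iff]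
      exact h (i + 1) (by omega))
    rw [revAltProd, Equiv.Perm.mul_apply, revAltProd, h₃, h₄, h₁, h₂, mul_assoc]
    exact ⟨rfl, rfl⟩

/-- A walk that meets its first loop after `i` steps is back at its starting point, up to the factor
picked up at the loop, after `2 * i + 1` steps. -/
theorem revAltProd_foldPerm_of_isLoop {s r : V} (hsr : s ≠ r) {i : ℕ} {k : V}
    {z : Γ.ArtinGroup × Γ.chambers K}
    (h : ∀ j < i, ¬∃ k, Γ.IsLoop K z.2 (Γ.coxeterMatrix.planeRoot s r j) k)
    (hk : Γ.IsLoop K z.2 (Γ.coxeterMatrix.planeRoot s r i) k) :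
    revAltProd (Γ.foldPerm K s) (Γ.foldPerm K r) (2 * i + 1) z = (Γ.σ k * z.1, z.2) := by
  induction i generalizing s r z with
  | zero =>
    rw [Γ.coxeterMatrix.planeRoot_zero hsr] at hk
    simpa [revAltProd] using foldPerm_of_isLoop hk
  | succ i ih =>
    have h₀ := h 0 i.succ_pos
    rw [Γ.coxeterMatrix.planeRoot_zero hsr] at h₀
    obtain ⟨h₁, h₂⟩ := foldPerm_of_not h₀
    have h₃ := ih hsr.symm (z := Γ.foldPerm K s z) (by
      intro j hj
      simp only [h₂, isLoop_simple_mul_iff]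
      exact h (j + 1) (by omega)) (by rw [h₂, isLoop_simple_mul_iff]; exact hk)
    have h₄ : 2 * (i + 1) + 1 = (2 * i + 1) + 1 + 1 := by ring
    rw [h₄, revAltProd, Equiv.Perm.mul_apply,
      revAltProd_add (Γ.foldPerm K r) (Γ.foldPerm K s) (2 * i + 1) 1,
      altLetter_two_mul_add_one, Equiv.Perm.mul_apply, h₃]
    have h₅ := foldPerm_of_not (z := (Γ.σ k * (Γ.foldPerm K s z).1, (Γ.foldPerm K s z).2)) (by
      simp only [h₂]
      exact not_isLoop_simple_mul z.2.2 s)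
    simp only [revAltProd, one_mul]
    refine Prod.ext (h₅.1.trans (by rw [h₁])) (Subtype.ext (h₅.2.trans ?_))
    simp only [h₂, Γ.coxeterMatrix.simple_mul_simple_mul]

end LabelledGraph


namespace CoxeterMatrix

open Finsupp LabelledGraph

variable {V : Type*} (M : CoxeterMatrix V)

theorem eq_of_cos_pi_div_eq {a b : ℕ} (hb : b ≠ 0)
    (h : Real.cos (Real.pi / a) = Real.cos (Real.pi / b)) : a = b := by
  have hmem (n : ℕ) : Real.pi / n ∈ Set.Icc 0 Real.pi := by
    refine ⟨by positivity, ?_⟩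
    rcases n.eq_zero_or_pos with rfl | hn
    · simpa using Real.pi_pos.le
    · exact div_le_self Real.pi_pos.le (by exact_mod_cast hn)
  have h₁ := Real.injOn_cos (hmem _) (hmem _) h
  have h₂ : (b : ℝ) ≠ 0 := by exact_mod_cast hb
  have h₃ : (a : ℝ) ≠ 0 := by
    intro h₃
    rw [h₃, div_zero, eq_comm, div_eq_zero_iff] at h₁
    exact h₁.elim Real.pi_ne_zero h₂
  rw [div_eq_div_iff h₃ h₂, mul_right_inj' Real.pi_ne_zero] at h₁
  exact_mod_cast h₁.symm

theorem rootCoeff_mul_sub {u v : V} (h : u ≠ v) (i j : ℕ) :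
    M.rootCoeff u v (i + j) * M.rootCoeff u v (i + 1) -
      M.rootCoeff u v i * M.rootCoeff u v (i + j + 1) = M.rootCoeff u v j := by
  induction i with
  | zero => simp [rootCoeff_zero, M.rootCoeff_one h]
  | succ i ih =>
    have e : i + 1 + j + 1 = i + j + 2 := by ring
    rw [e, M.rootCoeff_add_two, M.rootCoeff_add_two, add_right_comm i 1 j]
    linear_combination ih

theorem planeRoot_wedge {u v : V} (h : u ≠ v) (i j : ℕ) :
    M.rootCoeff u v (i + j) • M.planeRoot u v i - M.rootCoeff u v i • M.planeRoot u v (i + j) =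
      M.rootCoeff u v j • single u 1 := by
  rw [← M.rootCoeff_mul_sub h i j, planeRoot, planeRoot]
  module

/-- Among two positive roots of a finite rank two subsystem which are simple for another chamber,
the first one is an end of the subsystem. -/
theorem eq_zero_of_geomRep_eq_planeRoot {u v k k' : V} (h : u ≠ v) {w : M.Group}
    {i i' : ℕ} (hi : i < i') (hi' : i' < M u v) (hk : M.geomRep w (single k 1) = M.planeRoot u v i)
    (hk' : M.geomRep w (single k' 1) = M.planeRoot u v i') : i = 0 := by
  by_contra hne
  obtain ⟨j, rfl⟩ := Nat.exists_eq_add_of_lt hi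
  rw [add_assoc] at hi hi' hk'
  set l := j + 1
  have ha : 0 < M.rootCoeff u v i := M.rootCoeff_pos h (by omega) fun _ => by omega
  have hb : 0 < M.rootCoeff u v (i + l) := M.rootCoeff_pos h (by omega) fun _ => by omega
  have hc : 0 < M.rootCoeff u v l := M.rootCoeff_pos h (by omega) fun _ => by omega
  have key := M.planeRoot_wedge h i l
  have hkk : k ≠ k' := by
    rintro rfl
    rw [← hk', hk, ← sub_smul] at key
    have h₁ := DFunLike.congr_fun key v
    simp only [planeRoot, Finsupp.smul_apply, Finsupp.add_apply, single_eq_same, smul_eq_mul,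
      single_eq_of_ne h.symm, mul_zero, zero_add, mul_one] at h₁
    have h₂ := (mul_eq_zero.1 h₁).resolve_right ha.ne'
    rw [h₂, zero_smul] at key
    have h₃ := DFunLike.congr_fun key u
    simp only [Finsupp.smul_apply, single_eq_same, smul_eq_mul, mul_one, Finsupp.zero_apply] at h₃
    exact hc.ne h₃
  have key' : M.rootCoeff u v l • M.geomRep w⁻¹ (single u 1) =
      M.rootCoeff u v (i + l) • single k 1 - M.rootCoeff u v i • single k' 1 := by
    rw [← map_smul, ← key, ← hk, ← hk', map_sub, map_smul, map_smul]
    simp only [← Module.End.mul_apply, ← map_mul, inv_mul_cancel, map_one, Module.End.one_apply]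
  have h₁ := DFunLike.congr_fun key' k
  have h₂ := DFunLike.congr_fun key' k'
  simp only [Finsupp.smul_apply, Finsupp.sub_apply, single_eq_same, smul_eq_mul, mul_one,
    single_eq_of_ne hkk, single_eq_of_ne hkk.symm, mul_zero, sub_zero, zero_sub] at h₁ h₂
  rcases M.geomRep_single_nonneg_or_nonpos w⁻¹ u with h₃ | h₃
  · have := mul_nonneg hc.le (h₃ k')
    linarith
  · have : M.geomRep w⁻¹ (single u 1) k ≤ 0 := h₃ k
    nlinarith

theorem formEntry_injective {u v u' v' : V} (h₀ : M u v ≠ 0)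
    (h : M.formEntry u' v' = M.formEntry u v) : M u' v' = M u v :=
  eq_of_cos_pi_div_eq h₀ (neg_injective h)

theorem eq_two_of_formEntry_eq_zero {u v : V} (h : M.formEntry u v = 0) : M u v = 2 := by
  refine eq_of_cos_pi_div_eq two_ne_zero ?_
  rw [Nat.cast_ofNat, Real.cos_pi_div_two]
  exact neg_eq_zero.1 h

end CoxeterMatrix

namespace LabelledGraph

open Finsupp

variable {V : Type*} {Γ : LabelledGraph V} {K : Set V}

theorem m_eq_of_coxeterMatrix_eq {u v : V} {n : ℕ} (h : u ≠ v) (hn : Γ.coxeterMatrix u v = n)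
    (h₀ : n ≠ 0) : Γ.m u v = n := by
  rw [Γ.coxeterMatrix_apply h] at hn
  cases hm : Γ.m u v with
  | top => simp [hm] at hn; omega
  | coe a => rw [hm, ENat.toNat_natCast] at hn; rw [hn]

theorem revAltProd_foldPerm_comm_of_isLoop {s r : V} (hsr : s ≠ r) {i j : ℕ} (hij : i ≤ j)
    (hm : Γ.coxeterMatrix s r = i + j + 1) {k : V} {z : Γ.ArtinGroup × Γ.chambers K}
    (hk : Γ.IsLoop K z.2 (Γ.coxeterMatrix.planeRoot s r i) k)
    (h : ∀ n < i + j + 1, n ≠ i → ¬∃ k, Γ.IsLoop K z.2 (Γ.coxeterMatrix.planeRoot s r n) k) :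
    revAltProd (Γ.foldPerm K s) (Γ.foldPerm K r) (i + j + 1) z =
      revAltProd (Γ.foldPerm K r) (Γ.foldPerm K s) (i + j + 1) z := by
  obtain ⟨a, rfl⟩ := Nat.exists_eq_add_of_le hij
  have hr (n : ℕ) (hn : n < i + (i + a) + 1) : Γ.coxeterMatrix.planeRoot r s n =
      Γ.coxeterMatrix.planeRoot s r (i + (i + a) - n) := by
    rw [← Γ.coxeterMatrix.planeRoot_sub (by omega) (by omega)]
    congr 1
    omega
  have hfree (n : ℕ) (hn : n < i + a) :
      ¬∃ k, Γ.IsLoop K z.2 (Γ.coxeterMatrix.planeRoot r s n) k := by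
    rw [hr n (by omega)]
    exact h _ (by omega) (by omega)
  have h₁ := revAltProd_foldPerm_of_isLoop hsr (fun n hn => h n (by omega) (by omega)) hk
  obtain ⟨h₂, h₃⟩ := revAltProd_foldPerm_of_not hsr.symm (n := a) (z := (Γ.σ k * z.1, z.2))
    fun n hn => hfree n (by omega)
  obtain ⟨h₄, h₅⟩ := revAltProd_foldPerm_of_not hsr.symm (n := a) (z := z)
    fun n hn => hfree n (by omega)
  set y := revAltProd (Γ.foldPerm K r) (Γ.foldPerm K s) a z with hy
  have h₆ := revAltProd_foldPerm_of_isLoop (altLetter_ne hsr.symm a) (i := i) (k := k) (z := y)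
    (fun n hn => by
      simp only [h₅, isLoop_revAltProd_iff]
      exact hfree _ (by omega))
    (by
      rw [h₅, isLoop_revAltProd_iff, hr _ (by omega)]
      convert hk using 2
      omega)
  have e₁ : i + (i + a) + 1 = (2 * i + 1) + a := by ring
  have e₂ : altLetter (Γ.foldPerm K s) (Γ.foldPerm K r) (2 * i + 1 + 1) = Γ.foldPerm K s :=
    altLetter_two_mul_add_one (Γ.foldPerm K r) (Γ.foldPerm K s) i
  conv_lhs => rw [e₁, revAltProd_add, Equiv.Perm.mul_apply, h₁, altLetter_two_mul_add_one, e₂]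
  conv_rhs => rw [e₁, add_comm, revAltProd_add, Equiv.Perm.mul_apply, ← hy,
    ← map_altLetter (Γ.foldPerm K), ← map_altLetter (Γ.foldPerm K), h₆]
  exact Prod.ext (h₂.trans (by rw [h₄])) (Subtype.ext (h₃.trans h₅.symm))

theorem revAltProd_foldPerm_of_isLoop_of_isLoop {s r k k' : V} {z : Γ.ArtinGroup × Γ.chambers K}
    (hk : Γ.IsLoop K z.2 (single s 1) k) (hk' : Γ.IsLoop K z.2 (single r 1) k') (n : ℕ) :
    revAltProd (Γ.foldPerm K s) (Γ.foldPerm K r) n z =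
      (revAltProd (Γ.σ k) (Γ.σ k') n * z.1, z.2) := by
  induction n generalizing s r k k' z with
  | zero => simp [revAltProd]
  | succ n ih =>
    rw [revAltProd, Equiv.Perm.mul_apply, foldPerm_of_isLoop hk,
      ih (z := (Γ.σ k * z.1, z.2)) hk' hk, revAltProd, mul_assoc]

theorem foldPerm_braid {s r : V} {n : ℕ} (hsr : s ≠ r) (hn : Γ.m s r = n) :
    altProd (Γ.foldPerm K s) (Γ.foldPerm K r) n = altProd (Γ.foldPerm K r) (Γ.foldPerm K s) n := by
  have h₀ := Γ.coxeterMatrix_ne_zero hsr hn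
  have hM : Γ.coxeterMatrix s r = n := by
    rw [Γ.coxeterMatrix_apply hsr, hn, ENat.toNat_natCast]
  rw [← revAltProd_comm_iff]
  refine Equiv.ext fun z => ?_
  have hr (i : ℕ) (hi : i < n) : Γ.coxeterMatrix.planeRoot r s i =
      Γ.coxeterMatrix.planeRoot s r (n - 1 - i) := by
    rw [← hM, Γ.coxeterMatrix.planeRoot_sub h₀ (by omega)]
  by_cases hfree : ∀ i < n, ¬∃ k, Γ.IsLoop K z.2 (Γ.coxeterMatrix.planeRoot s r i) k
  · have h₁ := revAltProd_foldPerm_of_not hsr hfree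
    have h₂ := revAltProd_foldPerm_of_not hsr.symm (n := n) (z := z) fun i hi => by
      rw [hr i hi]
      exact hfree _ (by omega)
    refine Prod.ext (h₁.1.trans h₂.1.symm) (Subtype.ext (h₁.2.trans (Eq.trans ?_ h₂.2.symm)))
    rw [← hM, Γ.coxeterMatrix.revAltProd_simple_comm]
  push Not at hfree
  obtain ⟨i, hi, k, hk⟩ := hfree
  by_cases huniq : ∀ j < n, j ≠ i → ¬∃ k, Γ.IsLoop K z.2 (Γ.coxeterMatrix.planeRoot s r j) k
  · obtain ⟨j, hj⟩ : ∃ j, n = i + j + 1 := ⟨n - i - 1, by omega⟩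
    subst hj
    rcases le_total i j with hij | hij
    · exact revAltProd_foldPerm_comm_of_isLoop hsr hij hM hk huniq
    · have hM' : Γ.coxeterMatrix r s = j + i + 1 := by
        rw [Γ.coxeterMatrix.symmetric, hM, add_comm j]
      have := revAltProd_foldPerm_comm_of_isLoop (k := k) (z := z) hsr.symm hij hM'
        (by
          rw [hr j (by omega)]
          convert hk using 2
          omega)
        (fun l hl hne => by
          rw [hr l (by omega)]
          exact huniq _ (by omega) (by omega))
      rw [add_comm j] at this
      exact this.symm
  push Not at huniq
  obtain ⟨j, hj, hne, k', hk'⟩ := huniq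
  have key : ∀ (i i' : ℕ) (k k' : V), i < i' → i' < n →
      Γ.IsLoop K z.2 (Γ.coxeterMatrix.planeRoot s r i) k →
      Γ.IsLoop K z.2 (Γ.coxeterMatrix.planeRoot s r i') k' →
      revAltProd (Γ.foldPerm K s) (Γ.foldPerm K r) n z =
        revAltProd (Γ.foldPerm K r) (Γ.foldPerm K s) n z := by
    intro i i' k k' hlt hi' hk hk'
    obtain rfl := Γ.coxeterMatrix.eq_zero_of_geomRep_eq_planeRoot hsr hlt (by omega) hk.2 hk'.2
    have h₁ : Γ.coxeterMatrix.planeRoot s r i' = Γ.coxeterMatrix.planeRoot r s (n - 1 - i') := by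
      rw [hr _ (by omega)]
      congr 1
      omega
    have h₂ : Γ.coxeterMatrix.planeRoot s r 0 = Γ.coxeterMatrix.planeRoot r s (n - 1) := by
      rw [hr _ (by omega)]
      congr 1
      omega
    have hM' : Γ.coxeterMatrix r s = n := by rw [Γ.coxeterMatrix.symmetric, hM]
    rw [h₁] at hk'
    have h₃ := hk
    rw [h₂] at h₃
    have h₄ := Γ.coxeterMatrix.eq_zero_of_geomRep_eq_planeRoot hsr.symm
      (by omega) (by omega) hk'.2 h₃.2
    rw [h₄, Γ.coxeterMatrix.planeRoot_zero hsr.symm] at hk'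
    rw [Γ.coxeterMatrix.planeRoot_zero hsr] at hk
    have hkk : k ≠ k' := by
      rintro rfl
      exact hsr ((single_left_inj one_ne_zero).1 (hk.2.symm.trans hk'.2))
    have h₅ : Γ.coxeterMatrix k k' = Γ.coxeterMatrix s r := by
      apply Γ.coxeterMatrix.formEntry_injective h₀
      rw [← CoxeterMatrix.form_single, ← Γ.coxeterMatrix.form_geomRep z.2, hk.2, hk'.2,
        CoxeterMatrix.form_single]
    rw [revAltProd_foldPerm_of_isLoop_of_isLoop hk hk',
      revAltProd_foldPerm_of_isLoop_of_isLoop hk' hk,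
      (revAltProd_comm_iff _ _ n).2 (Γ.altProd_σ_comm hkk
        (m_eq_of_coxeterMatrix_eq hkk (h₅.trans hM) (by omega)))]
  rcases lt_or_gt_of_ne hne with hlt | hlt
  · exact key j i k' k hlt hi hk' hk
  · exact key i j k k' hlt hj hk hk'

variable (Γ K) in
/-- The action of an Artin group on `A_Γ × chambers`. -/
noncomputable def foldHom : Γ.ArtinGroup →* Equiv.Perm (Γ.ArtinGroup × Γ.chambers K) :=
  Γ.liftArtin (Γ.foldPerm K) fun _ _ _ => foldPerm_braid

@[simp]
theorem foldHom_σ (v : V) : Γ.foldHom K (Γ.σ v) = Γ.foldPerm K v := Γ.liftArtin_σ _ _ v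

end LabelledGraph

namespace LabelledGraph

open Finsupp

variable {V : Type*} {Γ : LabelledGraph V} {K L : Set V}

variable (Γ) in
theorem one_mem_chambers (K : Set V) : 1 ∈ Γ.chambers K := fun k _ => by
  rw [map_one, Module.End.one_apply]
  exact single_nonneg.2 zero_le_one

theorem foldHom_one_mem {x : Γ.ArtinGroup} (hx : x ∈ Γ.specialSubgroup K) (g : Γ.ArtinGroup) :
    Γ.foldHom K x (g, ⟨1, Γ.one_mem_chambers K⟩) = (x * g, ⟨1, Γ.one_mem_chambers K⟩) := by
  induction hx using Subgroup.closure_induction generalizing g with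
  | mem x hx =>
    obtain ⟨k, hk, rfl⟩ := hx
    rw [foldHom_σ]
    exact foldPerm_of_isLoop (z := (g, ⟨1, Γ.one_mem_chambers K⟩)) ⟨hk, by simp⟩
  | one => simp
  | mul x y _ _ hx hy => rw [map_mul, Equiv.Perm.mul_apply, hy, hx, mul_assoc]
  | inv x _ hx => rw [map_inv, Equiv.Perm.inv_eq_iff_eq, hx, mul_inv_cancel_left]

/-- The states `(g, d)` reached by the special subgroup of `L`: `g` lies in the special subgroup of
`K ∩ L`, and `d` lies in the parabolic subgroup attached to `L`. -/
def reachable (Γ : LabelledGraph V) (K L : Set V) : Set (Γ.ArtinGroup × Γ.chambers K) :=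
  {z | z.1 ∈ Γ.specialSubgroup (K ∩ L) ∧
    ∀ y, ∀ u ∉ L, Γ.coxeterMatrix.geomRep z.2 y u = y u}

theorem foldPerm_mem_reachable_iff {s : V} (hs : s ∈ L) {z : Γ.ArtinGroup × Γ.chambers K} :
    Γ.foldPerm K s z ∈ Γ.reachable K L ↔ z ∈ Γ.reachable K L := by
  by_cases h : ∃ k, Γ.IsLoop K z.2 (single s 1) k
  · obtain ⟨k, hk⟩ := h
    rw [foldPerm_of_isLoop hk]
    refine and_congr_left fun hz =>
      mul_mem_cancel_left (Subgroup.subset_closure ⟨k, ⟨hk.1, ?_⟩, rfl⟩)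
    by_contra hkL
    have h₁ := hz (single k 1) k hkL
    rw [hk.2, single_eq_same, single_eq_of_ne (by rintro rfl; exact hkL hs)] at h₁
    exact zero_ne_one h₁
  · obtain ⟨h₁, h₂⟩ := foldPerm_of_not h
    simp only [reachable, Set.mem_ofPred_eq, h₁, h₂, map_mul, Module.End.mul_apply,
      CoxeterMatrix.geomRep_simple]
    refine and_congr_right fun _ => forall_congr' fun y => forall₂_congr fun u hu => ?_
    rw [Γ.coxeterMatrix.simpleRefl_apply_of_ne (by rintro rfl; exact hu hs)]

theorem foldHom_mem_reachable_iff {x : Γ.ArtinGroup} (hx : x ∈ Γ.specialSubgroup L)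
    (z : Γ.ArtinGroup × Γ.chambers K) :
    Γ.foldHom K x z ∈ Γ.reachable K L ↔ z ∈ Γ.reachable K L := by
  induction hx using Subgroup.closure_induction generalizing z with
  | mem x hx =>
    obtain ⟨s, hs, rfl⟩ := hx
    rw [foldHom_σ, foldPerm_mem_reachable_iff hs]
  | one => simp
  | mul x y _ _ hx hy => rw [map_mul, Equiv.Perm.mul_apply, hx, hy]
  | inv x _ hx =>
    rw [← hx, ← Equiv.Perm.mul_apply, ← map_mul, mul_inv_cancel, map_one, Equiv.Perm.one_apply]

variable (Γ) in
/-- Special subgroups of an Artin group intersect in special subgroups (van der Lek). -/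
theorem specialSubgroup_inf_le (K L : Set V) :
    Γ.specialSubgroup K ⊓ Γ.specialSubgroup L ≤ Γ.specialSubgroup (K ∩ L) := by
  rintro x ⟨hK, hL⟩
  have h := (foldHom_mem_reachable_iff (K := K) hL (1, ⟨1, Γ.one_mem_chambers K⟩)).2
    ⟨one_mem _, by simp⟩
  rw [foldHom_one_mem hK, mul_one] at h
  exact h.1

variable (Γ) in
/-- The homomorphism to `ℤ` which takes the value `1` on every standard generator. -/
def exponent : Γ.ArtinGroup →* Multiplicative ℤ :=
  Γ.liftArtin (fun _ => Multiplicative.ofAdd 1) fun _ _ _ _ _ => rfl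

theorem σ_zpow_eq_one {v : V} {n : ℤ} (h : Γ.σ v ^ n = 1) : n = 0 := by
  have h₁ := congrArg Γ.exponent h
  rw [map_zpow, map_one, exponent, liftArtin_σ, ← ofAdd_zsmul] at h₁
  simpa using h₁

theorem σ_ne_one (v : V) : Γ.σ v ≠ 1 := fun h =>
  one_ne_zero (σ_zpow_eq_one (n := 1) (by rw [zpow_one, h]))

theorem specialSubgroup_singleton (v : V) : Γ.specialSubgroup {v} = Subgroup.zpowers (Γ.σ v) := by
  rw [specialSubgroup, Set.image_singleton, Subgroup.zpowers_eq_closure]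

theorem σ_notMem_specialSubgroup {v : V} (h : v ∉ L) : Γ.σ v ∉ Γ.specialSubgroup L := fun hv => by
  have h₁ := Γ.specialSubgroup_inf_le {v} L
    ⟨Subgroup.subset_closure (Set.mem_image_of_mem _ rfl), hv⟩
  rw [Set.singleton_inter_eq_empty.2 h, specialSubgroup, Set.image_empty, Subgroup.closure_empty,
    Subgroup.mem_bot] at h₁
  exact σ_ne_one v h₁

theorem zpow_eq_zero_of_commute {s t : V} (hst : s ≠ t) (hm : Γ.m s t ≠ 2) {n : ℤ}
    (h : Commute (Γ.σ t ^ n) (Γ.σ s)) : n = 0 := by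
  have hloop (d : Γ.coxeterMatrix.Group) (u : V)
      (hd : Γ.coxeterMatrix.geomRep d (single t 1) ≠ single u 1) :
      ¬∃ k, Γ.IsLoop {t} d (single u 1) k := by
    rintro ⟨k, rfl, hk⟩
    exact hd hk
  have hB : Γ.coxeterMatrix.formEntry s t ≠ 0 := fun h₀ => hm <| by
    exact_mod_cast m_eq_of_coxeterMatrix_eq hst
      (Γ.coxeterMatrix.eq_two_of_formEntry_eq_zero h₀) two_ne_zero
  have h₁ (g : Γ.ArtinGroup) := foldPerm_of_not (z := (g, ⟨1, Γ.one_mem_chambers {t}⟩))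
    (hloop 1 s (by simpa [single_left_inj] using hst.symm))
  set z := Γ.foldPerm {t} s (1, ⟨1, Γ.one_mem_chambers {t}⟩) with hz
  have hz₂ : (z.2 : Γ.coxeterMatrix.Group) = Γ.coxeterMatrix.simple s := by
    rw [(h₁ 1).2, mul_one]
  have h₂ := foldPerm_of_not (z := z) (hloop z.2 t (by
    rw [hz₂, CoxeterMatrix.geomRep_simple, CoxeterMatrix.simpleRefl_apply,
      CoxeterMatrix.form_single]
    intro h₀
    have := DFunLike.congr_fun h₀ s
    simp [hst, hB] at this))
  have h₃ := foldPerm_of_not (z := Γ.foldPerm {t} t z) (by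
    rw [h₂.2]
    exact not_isLoop_simple_mul z.2.2 t)
  have h₄ : Γ.foldHom {t} (Γ.σ t * Γ.σ t) z = z := by
    rw [map_mul, foldHom_σ, Equiv.Perm.mul_apply]
    refine Prod.ext (h₃.1.trans h₂.1) (Subtype.ext (h₃.2.trans ?_))
    rw [h₂.2, CoxeterMatrix.simple_mul_simple_mul]
  have h₅ : Γ.foldHom {t} ((Γ.σ t * Γ.σ t) ^ n) z = z := by
    rw [map_zpow]
    exact Equiv.Perm.zpow_apply_eq_self_of_apply_eq_self h₄ n
  have h₆ : (Γ.σ t * Γ.σ t) ^ n = Γ.σ t ^ (n + n) := by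
    rw [(Commute.refl _).mul_zpow, zpow_add]
  have h₇ : Commute (Γ.σ t ^ (n + n)) (Γ.σ s) := by
    rw [zpow_add]
    exact h.mul_left h
  have h₈ : Γ.σ t ^ (n + n) ∈ Γ.specialSubgroup {t} := by
    rw [specialSubgroup_singleton]
    exact Subgroup.zpow_mem_zpowers _ _
  rw [h₆, hz, ← foldHom_σ, ← Equiv.Perm.mul_apply, ← map_mul, h₇.eq, map_mul,
    Equiv.Perm.mul_apply, foldHom_one_mem h₈, mul_one, foldHom_σ] at h₅
  have h₉ := (h₁ _).1.symm.trans ((congrArg Prod.fst h₅).trans (h₁ 1).1)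
  have := σ_zpow_eq_one h₉
  omega

end LabelledGraph

namespace Monoid.PushoutI

variable {ι H : Type*} {G : ι → Type*} [∀ i, Group (G i)] [Group H] {φ : ∀ i, H →* G i}

/-- The product of a nonempty reduced word whose first letter lies in `G i` and whose last letter
lies in `G j`. -/
inductive IsReducedProd (φ : ∀ i, H →* G i) : ι → ι → PushoutI φ → Prop
  | of (i : ι) (x : G i) (hx : x ∉ (φ i).range) : IsReducedProd φ i i (of i x)
  | cons (i k j : ι) (x : G i) (z : PushoutI φ) (hx : x ∉ (φ i).range) (hik : i ≠ k)
      (hz : IsReducedProd φ k j z) : IsReducedProd φ i j (PushoutI.of i x * z)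

namespace IsReducedProd

theorem mul {i j k l : ι} {y z : PushoutI φ} (hy : IsReducedProd φ i j y) (hjk : j ≠ k)
    (hz : IsReducedProd φ k l z) : IsReducedProd φ i l (y * z) := by
  induction hy with
  | of i x hx => exact cons i k l x z hx hjk hz
  | cons i m j x y hx him _ ih =>
    rw [mul_assoc]
    exact cons i m l x _ hx him (ih hjk)

theorem inv {i j : ι} {z : PushoutI φ} (hz : IsReducedProd φ i j z) :
    IsReducedProd φ j i z⁻¹ := by
  induction hz with
  | of i x hx =>
    rw [← map_inv]
    exact of i x⁻¹ (by rwa [inv_mem_iff])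
  | cons i k j x z hx hik _ ih =>
    rw [mul_inv_rev, ← map_inv]
    exact ih.mul hik.symm (of i x⁻¹ (by rwa [inv_mem_iff]))

theorem base_mul {i j : ι} {z : PushoutI φ} (hz : IsReducedProd φ i j z) (h : H) :
    IsReducedProd φ i j (base φ h * z) := by
  cases hz with
  | of _ x hx =>
    rw [← of_apply_eq_base φ i, ← map_mul]
    exact of i _ (by rwa [(φ i).range.mul_mem_cancel_left ⟨h, rfl⟩])
  | cons _ k _ x z hx hik hz =>
    rw [← of_apply_eq_base φ i, ← mul_assoc, ← map_mul]
    exact cons i k j _ z (by rwa [(φ i).range.mul_mem_cancel_left ⟨h, rfl⟩]) hik hz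

theorem exists_word {i j : ι} {z : PushoutI φ} (hz : IsReducedProd φ i j z) :
    ∃ w : CoprodI.Word G, Reduced φ w ∧ w.fstIdx = some i ∧ ofCoprodI w.prod = z := by
  have ne_one {i : ι} {x : G i} (hx : x ∉ (φ i).range) : x ≠ 1 := by
    rintro rfl
    exact hx (one_mem _)
  induction hz with
  | of i x hx =>
    have hi : (CoprodI.Word.empty : CoprodI.Word G).fstIdx ≠ some i := by
      simp [CoprodI.Word.fstIdx, CoprodI.Word.empty]
    refine ⟨.cons x .empty hi (ne_one hx), ?_, by simp, by simp⟩
    intro g hg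
    obtain rfl : g = ⟨i, x⟩ := by simpa [CoprodI.Word.cons, CoprodI.Word.empty] using hg
    exact hx
  | cons i k j x z hx hik _ ih =>
    obtain ⟨w, hw, hwk, rfl⟩ := ih
    refine ⟨.cons x w (by simpa [hwk] using hik.symm) (ne_one hx), ?_, by simp, by simp⟩
    intro g hg
    rcases List.mem_cons.1 hg with rfl | hg
    · exact hx
    · exact hw g hg

theorem notMem_range (hφ : ∀ i, Function.Injective (φ i)) {i j : ι} {z : PushoutI φ}
    (hz : IsReducedProd φ i j z) : z ∉ (base φ).range := by
  rintro h
  obtain ⟨w, hw, hwi, rfl⟩ := hz.exists_word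
  obtain rfl := hw.eq_empty_of_mem_range hφ h
  simp [CoprodI.Word.fstIdx, CoprodI.Word.empty] at hwi

theorem ne_one (hφ : ∀ i, Function.Injective (φ i)) {i j : ι} {z : PushoutI φ}
    (hz : IsReducedProd φ i j z) : z ≠ 1 := by
  rintro rfl
  exact hz.notMem_range hφ (one_mem _)

end IsReducedProd

theorem mem_range_or_isReducedProd (z : PushoutI φ) :
    z ∈ (base φ).range ∨ ∃ i j, IsReducedProd φ i j z := by
  have base_mul (h : H) (y : PushoutI φ)
      (hy : y ∈ (base φ).range ∨ ∃ i j, IsReducedProd φ i j y) :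
      base φ h * y ∈ (base φ).range ∨ ∃ i j, IsReducedProd φ i j (base φ h * y) := by
    rcases hy with hy | ⟨i, j, hy⟩
    · exact Or.inl (mul_mem ⟨h, rfl⟩ hy)
    · exact Or.inr ⟨i, j, hy.base_mul h⟩
  suffices h : ∀ y : PushoutI φ, (y ∈ (base φ).range ∨ ∃ i j, IsReducedProd φ i j y) →
      (z * y ∈ (base φ).range ∨ ∃ i j, IsReducedProd φ i j (z * y)) by
    simpa using h 1 (Or.inl (one_mem _))
  induction z using PushoutI.induction_on with
  | of i x =>
    intro y hy
    by_cases hx : x ∈ (φ i).range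
    · obtain ⟨h, rfl⟩ := hx
      rw [of_apply_eq_base]
      exact base_mul h y hy
    rcases hy with ⟨h, rfl⟩ | ⟨k, j, hy⟩
    · rw [← of_apply_eq_base φ i, ← map_mul]
      exact Or.inr ⟨i, i, .of i _ (by rwa [(φ i).range.mul_mem_cancel_right ⟨h, rfl⟩])⟩
    by_cases hik : i = k
    swap
    · exact Or.inr ⟨i, j, .cons i k j x y hx hik hy⟩
    subst hik
    cases hy with
    | of _ x' _ =>
      rw [← map_mul]
      by_cases hxx : x * x' ∈ (φ i).range
      · obtain ⟨h, hh⟩ := hxx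
        rw [← hh, of_apply_eq_base]
        exact Or.inl ⟨h, rfl⟩
      · exact Or.inr ⟨i, i, .of i _ hxx⟩
    | cons _ k _ x' z _ hik hz =>
      rw [← mul_assoc, ← map_mul]
      by_cases hxx : x * x' ∈ (φ i).range
      · obtain ⟨h, hh⟩ := hxx
        rw [← hh, of_apply_eq_base]
        exact Or.inr ⟨k, j, hz.base_mul h⟩
      · exact Or.inr ⟨i, j, .cons i k j _ z hxx hik hz⟩
  | base h => exact base_mul h
  | mul x y hx hy =>
    intro z hz
    rw [mul_assoc]
    exact hx _ (hy z hz)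

/-- The center of a nontrivial amalgamated product is contained in the amalgamated subgroup. -/
theorem center_le_range_base [Nontrivial ι] (hφ : ∀ i, Function.Injective (φ i))
    (hφ' : ∀ i, (φ i).range ≠ ⊤) : Subgroup.center (PushoutI φ) ≤ (base φ).range := by
  intro z hz
  refine (mem_range_or_isReducedProd z).resolve_right ?_
  rintro ⟨i, j, h⟩
  have hcomm (g : PushoutI φ) : g * z * g⁻¹ * z⁻¹ = 1 := by
    rw [Subgroup.mem_center_iff.1 hz g]
    group
  by_cases hij : i = j
  · subst hij
    obtain ⟨k, hk⟩ := exists_ne i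
    obtain ⟨x, hx⟩ : ∃ x, x ∉ (φ k).range := by
      by_contra! hall
      exact hφ' k ((Subgroup.eq_top_iff' _).2 hall)
    have hg := IsReducedProd.of k x hx
    exact (((hg.mul hk h).mul hk.symm hg.inv).mul hk h.inv).ne_one hφ (hcomm _)
  · have h' := h
    cases h with
    | of => exact hij rfl
    | cons _ k _ x y hx hik hy =>
      refine ((hy.mul (Ne.symm hij) (.of i x hx)).mul hij h'.inv).ne_one hφ ?_
      have := hcomm (of i x)⁻¹
      rwa [inv_inv, inv_mul_cancel_left] at this

end Monoid.PushoutI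

namespace LabelledGraph

open Monoid

variable {V : Type*} {Γ : LabelledGraph V}

theorem altProd_mem {G : Type*} [Group G] (S : Subgroup G) (x y : S) (n : ℕ) :
    (altProd x y n : S) = altProd (x : G) (y : G) n := map_altProd S.subtype x y n

/-- If `m v w = ∞`, then the Artin group is an amalgam of the special subgroups which omit `v` and
`w` respectively, so its center lies in both. -/
theorem center_le_specialSubgroup_compl {v w : V} (hvw : v ≠ w) (hm : Γ.m v w = ⊤) :
    Subgroup.center Γ.ArtinGroup ≤ Γ.specialSubgroup {v}ᶜ := by
  classical
  let f : Bool → V := fun b => bif b then v else w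
  let G : Bool → Subgroup Γ.ArtinGroup := fun b => Γ.specialSubgroup {f b}ᶜ
  let H : Subgroup Γ.ArtinGroup := ⨅ b, G b
  let φ : ∀ b, H →* G b := fun b => Subgroup.inclusion (iInf_le G b)
  have hf (b : Bool) : f b ≠ f !b := by cases b <;> simp [f, hvw, hvw.symm]
  have hmem {u : V} {b : Bool} (h : f b ≠ u) : Γ.σ u ∈ G b :=
    Subgroup.subset_closure (Set.mem_image_of_mem _ h.symm)
  have hex (u : V) : ∃ b, f b ≠ u := by
    by_contra! h
    exact hf true ((h _).trans (h _).symm)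
  choose c hc using hex
  let γ : V → PushoutI φ := fun u => PushoutI.of (c u) ⟨Γ.σ u, hmem (hc u)⟩
  have hγ {u : V} {b : Bool} (h : f b ≠ u) : γ u = PushoutI.of b ⟨Γ.σ u, hmem h⟩ := by
    by_cases hb : b = c u
    · subst hb
      rfl
    · have hH : Γ.σ u ∈ H := by
        refine Subgroup.mem_iInf.2 fun b' => ?_
        by_cases hb' : b' = b
        · exact hb' ▸ hmem h
        · have : b' = c u := by cases b' <;> cases b <;> cases hcu : c u <;> simp_all
          exact this ▸ hmem (hc u)
      exact (PushoutI.of_apply_eq_base φ (c u) ⟨_, hH⟩).trans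
        (PushoutI.of_apply_eq_base φ b ⟨_, hH⟩).symm
  let ψ : Γ.ArtinGroup →* PushoutI φ := Γ.liftArtin γ <| by
    intro a b n hab hn
    obtain ⟨i, ha, hb⟩ : ∃ i, f i ≠ a ∧ f i ≠ b := by
      by_contra! h
      by_cases hva : v = a
      · have hwb : w = b := h false fun hwa => hvw (hva.trans hwa.symm)
        rw [← hva, ← hwb, hm] at hn
        exact ENat.top_ne_natCast n hn
      · have hvb : v = b := h true hva
        have hwa : w = a := by
          by_contra hwa
          exact hvw (hvb.trans (h false hwa).symm)
        rw [← hvb, ← hwa, Γ.symm, hm] at hn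
        exact ENat.top_ne_natCast n hn
    rw [hγ ha, hγ hb, ← map_altProd, ← map_altProd]
    congr 1
    apply Subtype.ext
    rw [altProd_mem, altProd_mem]
    exact Γ.altProd_σ_comm hab hn
  let χ : PushoutI φ →* Γ.ArtinGroup := PushoutI.lift (fun b => (G b).subtype) H.subtype
    fun b => rfl
  have hψ {b : Bool} {x : Γ.ArtinGroup} (hx : x ∈ G b) : ψ x = PushoutI.of b ⟨x, hx⟩ := by
    induction hx using Subgroup.closure_induction with
    | mem x hx =>
      obtain ⟨u, hu, rfl⟩ := hx
      exact (Γ.liftArtin_σ _ _ u).trans (hγ (Ne.symm hu))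
    | one => exact (map_one ψ).trans (map_one _).symm
    | mul x y hx hy ihx ihy =>
      rw [map_mul, ihx, ihy, ← map_mul]
      rfl
    | inv x hx ih =>
      rw [map_inv, ih, ← map_inv]
      rfl
  have hψχ (p : PushoutI φ) : ψ (χ p) = p := by
    refine DFunLike.congr_fun (?_ : ψ.comp χ = MonoidHom.id _) p
    refine PushoutI.hom_ext_nonempty fun b => MonoidHom.ext fun x => ?_
    simp only [MonoidHom.comp_apply, χ, MonoidHom.id_apply]
    exact hψ x.2
  have hχψ (x : Γ.ArtinGroup) : χ (ψ x) = x := by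
    refine DFunLike.congr_fun (?_ : χ.comp ψ = MonoidHom.id _) x
    refine PresentedGroup.ext fun u => ?_
    change χ (ψ (Γ.σ u)) = Γ.σ u
    simp only [ψ, liftArtin_σ, γ, χ]
    rfl
  intro z hz
  have hz' : ψ z ∈ Subgroup.center (PushoutI φ) := by
    refine Subgroup.mem_center_iff.2 fun p => ?_
    rw [← hψχ p, ← map_mul, ← map_mul, Subgroup.mem_center_iff.1 hz]
  obtain ⟨h, hh⟩ := PushoutI.center_le_range_base
    (fun b => Subgroup.inclusion_injective (iInf_le G b)) (fun b htop => by
      have h₁ : (⟨Γ.σ (f !b), hmem (hf b)⟩ : G b) ∈ (φ b).range := htop ▸ Subgroup.mem_top _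
      obtain ⟨y, hy⟩ := h₁
      have h₂ : Γ.σ (f !b) ∈ G !b := by
        have h₃ : (y : Γ.ArtinGroup) = Γ.σ (f !b) := congrArg Subtype.val hy
        exact h₃ ▸ iInf_le G (!b) y.2
      exact σ_notMem_specialSubgroup (by simp) h₂) hz'
  rw [← hχψ z, ← hh]
  exact iInf_le G true h.2

end LabelledGraph

namespace LabelledGraph

variable {V : Type*} {Γ : LabelledGraph V}

theorem center_le_specialSubgroup_compl_of_not_isConePoint {v : V} (hv : ¬Γ.IsConePoint v) :
    Subgroup.center Γ.ArtinGroup ≤ Γ.specialSubgroup {v}ᶜ := by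
  simp only [IsConePoint, not_forall, not_not] at hv
  obtain ⟨w, hwv, hm⟩ := hv
  exact center_le_specialSubgroup_compl hwv.symm hm

/-- The center is supported on the cone points. -/
theorem center_le_specialSubgroup_conePoints [Finite V] :
    Subgroup.center Γ.ArtinGroup ≤ Γ.specialSubgroup {v | Γ.IsConePoint v} := by
  suffices h : ∀ S : Set V, S.Finite → (∀ v ∈ S, ¬Γ.IsConePoint v) →
      Subgroup.center Γ.ArtinGroup ≤ Γ.specialSubgroup Sᶜ by
    have := h {v | Γ.IsConePoint v}ᶜ (Set.toFinite _) fun v hv => hv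
    rwa [compl_compl] at this
  intro S hS
  induction S, hS using Set.Finite.induction_on with
  | empty =>
    intro _
    rw [Set.compl_empty, specialSubgroup, Set.image_univ]
    exact le_top.trans (PresentedGroup.closure_range_of _).ge
  | @insert v S _ _ ih =>
    intro h
    rw [Set.insert_eq, Set.compl_union]
    exact (le_inf (center_le_specialSubgroup_compl_of_not_isConePoint (h v (Set.mem_insert _ _)))
      (ih fun u hu => h u (Set.mem_insert_of_mem _ hu))).trans (Γ.specialSubgroup_inf_le _ _)

theorem σ_mem_center {t : V} (h : ∀ s, s ≠ t → Γ.m s t = 2) :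
    Γ.σ t ∈ Subgroup.center Γ.ArtinGroup := by
  have h₁ : Subgroup.closure (Set.range Γ.σ) ≤ Subgroup.centralizer {Γ.σ t} := by
    rw [Subgroup.closure_le]
    rintro _ ⟨s, rfl⟩
    refine Subgroup.mem_centralizer_singleton_iff.2 ?_
    by_cases hs : s = t
    · rw [hs]
    · have := Γ.altProd_σ_comm (n := 2) hs (h s hs)
      simpa [altProd] using this
  refine Subgroup.mem_center_iff.2 fun g => Subgroup.mem_centralizer_singleton_iff.1 (h₁ ?_)
  have h₂ : Subgroup.closure (Set.range Γ.σ) = ⊤ := PresentedGroup.closure_range_of _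
  exact h₂ ▸ Subgroup.mem_top g

end LabelledGraph

/-- If `Γ` has at least two vertices and its set of cone points is
exactly `{t}`, then `Z(A_Γ)` is trivial iff there is a vertex `s ≠ t` with
`m s t ≠ 2`; moreover if `m s t = 2` for all `s ≠ t`, then the cyclic subgroup
generated by `σ t` is contained in `Z(A_Γ)`. -/
theorem center_single_conePoint {V : Type*} [Finite V] (Γ : LabelledGraph V) (t : V)
    (hcard : 1 < Nat.card V) (hT : {v | Γ.IsConePoint v} = {t}) :
    (Subgroup.center Γ.ArtinGroup = ⊥ ↔ ∃ s : V, s ≠ t ∧ Γ.m s t ≠ 2) ∧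
    ((∀ s : V, s ≠ t → Γ.m s t = 2) →
      Subgroup.zpowers (Γ.σ t) ≤ Subgroup.center Γ.ArtinGroup) := by
  refine ⟨⟨fun h => ?_, ?_⟩, fun h => ?_⟩
  · by_contra! hall
    have h₁ := LabelledGraph.σ_mem_center hall
    rw [h, Subgroup.mem_bot] at h₁
    exact LabelledGraph.σ_ne_one t h₁
  · rintro ⟨s, hst, hm⟩
    refine (Subgroup.eq_bot_iff_forall _).2 fun z hz => ?_
    have h₁ := LabelledGraph.center_le_specialSubgroup_conePoints hz
    rw [hT, LabelledGraph.specialSubgroup_singleton] at h₁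
    obtain ⟨n, rfl⟩ := Subgroup.mem_zpowers_iff.1 h₁
    rw [LabelledGraph.zpow_eq_zero_of_commute hst hm (Subgroup.mem_center_iff.1 hz _).symm,
      zpow_zero]
  · rw [Subgroup.zpowers_le]
    exact LabelledGraph.σ_mem_center h
end

section
/- Let Γ be an irreducible labelled graph with vertex set V and let z ∈ A_Γ be a positive element (a product of generators σ_v with no inverses) such that either z is central in A_Γ and has infinite order, or z is a nontrivial central element of the pure Artin group PA_Γ. Then there is no proper subset K ⊊ V with z ∈ A_K. -/
namespace LabelledGraph

variable {V : Type*}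

/-- The coefficients of alternating products of the two Burau generators in the dihedral
case satisfy a Chebyshev recursion. -/
theorem exists_altProd_one_sub {R : Type*} [Ring R] [Algebra ℝ R] (t θ : ℝ) {A B X Y : R}
    (hAA : A * A = (1 + t ^ 2) • A) (hAB : A * B = (-2 * t * Real.cos θ) • X)
    (hAX : A * X = (1 + t ^ 2) • X) (hAY : A * Y = (-2 * t * Real.cos θ) • A)
    (hBB : B * B = (1 + t ^ 2) • B) (hBA : B * A = (-2 * t * Real.cos θ) • Y)
    (hBY : B * Y = (1 + t ^ 2) • Y) (hBX : B * X = (-2 * t * Real.cos θ) • B) (n : ℕ) :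
    ∃ a a' x x' : ℝ,
      altProd (1 - A) (1 - B) n = 1 + a • A + a' • B + x • X + x' • Y ∧
      altProd (1 - B) (1 - A) n = 1 + a • B + a' • A + x • Y + x' • X ∧
      t * Real.sin θ * ((a + x) - (a' + x')) = -t ^ n * Real.sin (n * θ) ∧
      Real.sin θ * (-1 - t ^ 2 * (a' + x') + 2 * t * Real.cos θ * (a + x) - (a + x)) =
        -t ^ n * Real.sin ((n + 1) * θ) ∧
      -t * Real.sin θ * ((a - x) - (a' - x')) = -(-t) ^ n * Real.sin (n * θ) ∧
      Real.sin θ * (-1 - t ^ 2 * (a' - x') - 2 * t * Real.cos θ * (a - x) - (a - x)) =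
        -(-t) ^ n * Real.sin ((n + 1) * θ) := by
  induction n with
  | zero => exact ⟨0, 0, 0, 0, by simp [altProd]⟩
  | succ n ih =>
    obtain ⟨a, a', x, x', hP, hQ, h1, h2, h3, h4⟩ := ih
    have hsin : Real.sin ((n + 1 + 1) * θ) =
        2 * Real.cos θ * Real.sin ((n + 1) * θ) - Real.sin (n * θ) := by
      have e1 : ((n : ℝ) + 1 + 1) * θ = (n + 1) * θ + θ := by ring
      have e2 : (n : ℝ) * θ = (n + 1) * θ - θ := by ring
      rw [e1, e2, Real.sin_add, Real.sin_sub]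
      ring
    refine ⟨-1 - t ^ 2 * a' + 2 * t * Real.cos θ * x, a,
      -t ^ 2 * x' + 2 * t * Real.cos θ * a, x, ?_, ?_, ?_, ?_, ?_, ?_⟩
    · rw [altProd, hQ]
      simp only [sub_mul, mul_add, one_mul, mul_one, mul_smul_comm, hAA, hAB, hAX, hAY]
      module
    · rw [altProd, hP]
      simp only [sub_mul, mul_add, one_mul, mul_one, mul_smul_comm, hBB, hBA, hBX, hBY]
      module
    · push_cast
      linear_combination t * h2
    · push_cast
      rw [hsin]
      linear_combination (2 * t * Real.cos θ) * h2 - t * h1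
    · push_cast
      linear_combination -t * h4
    · push_cast
      rw [hsin]
      linear_combination (-2 * t * Real.cos θ) * h4 + t * h3

/-- Two generators satisfying the Burau relations with angle `π / k` satisfy the braid relation
of length `k`. -/
theorem altProd_one_sub_comm {R : Type*} [Ring R] [Algebra ℝ R] {t : ℝ} (ht : t ≠ 0) {k : ℕ}
    (hk : 2 ≤ k) {A B X Y : R}
    (hAA : A * A = (1 + t ^ 2) • A) (hAB : A * B = (-2 * t * Real.cos (Real.pi / k)) • X)
    (hAX : A * X = (1 + t ^ 2) • X) (hAY : A * Y = (-2 * t * Real.cos (Real.pi / k)) • A)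
    (hBB : B * B = (1 + t ^ 2) • B) (hBA : B * A = (-2 * t * Real.cos (Real.pi / k)) • Y)
    (hBY : B * Y = (1 + t ^ 2) • Y) (hBX : B * X = (-2 * t * Real.cos (Real.pi / k)) • B) :
    altProd (1 - A) (1 - B) k = altProd (1 - B) (1 - A) k := by
  obtain ⟨a, a', x, x', hP, hQ, h1, -, h3, -⟩ :=
    exists_altProd_one_sub t (Real.pi / k) hAA hAB hAX hAY hBB hBA hBY hBX k
  have hk' : (2 : ℝ) ≤ k := by exact_mod_cast hk
  have hsin : Real.sin (Real.pi / k) ≠ 0 := by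
    refine (Real.sin_pos_of_pos_of_lt_pi (by positivity) ?_).ne'
    exact div_lt_self Real.pi_pos (by linarith)
  have hkπ : (k : ℝ) * (Real.pi / k) = Real.pi := by field_simp
  rw [hkπ, Real.sin_pi, mul_zero] at h1 h3
  have h1' : (a + x) - (a' + x') = 0 := by simpa [ht, hsin] using h1
  have h3' : (a - x) - (a' - x') = 0 := by simpa [ht, hsin] using h3
  obtain rfl : a = a' := by linarith
  obtain rfl : x = x' := by linarith
  rw [hP, hQ]
  abel

section Burau

variable [DecidableEq V]

/-- The Gram matrix of the generalized Burau form of `Γ` at parameter `q = 4`. -/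
noncomputable def burauForm (Γ : LabelledGraph V) (u v : V) : ℝ :=
  if u = v then 5 else -4 * Real.cos (Real.pi / (Γ.m u v).toNat)

theorem burauForm_self (Γ : LabelledGraph V) (v : V) : Γ.burauForm v v = 5 := if_pos rfl

theorem burauForm_symm (Γ : LabelledGraph V) (u v : V) :
    Γ.burauForm u v = Γ.burauForm v u := by
  simp only [burauForm, Γ.symm u v, eq_comm]

theorem burauForm_ne_zero (Γ : LabelledGraph V) {u v : V} (huv : u ≠ v) (hm : Γ.m u v ≠ 2) :
    Γ.burauForm u v ≠ 0 := by
  rw [burauForm, if_neg huv]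
  refine mul_ne_zero (by norm_num) (Real.cos_pos_of_mem_Ioo ⟨?_, ?_⟩).ne'
  · have : 0 ≤ Real.pi / ((Γ.m u v).toNat : ℝ) := by positivity
    linarith [Real.pi_pos]
  · have h2 := Γ.two_le u v huv
    generalize Γ.m u v = m at *
    cases m with
    | top => simpa using Real.pi_pos
    | coe k =>
      have hk : 2 < k := lt_of_le_of_ne (by exact_mod_cast h2) (by rintro rfl; exact hm rfl)
      rw [ENat.toNat_natCast]
      exact div_lt_div_of_pos_left Real.pi_pos two_pos (by exact_mod_cast hk)

variable [Fintype V]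

open Matrix

/-- The rank one matrix `x ↦ ⟪v, x⟫ e_u` attached to the Burau form, where `⟪·, ·⟫` is that form. -/
noncomputable def burauRankOne (Γ : LabelledGraph V) (u v : V) : Matrix V V ℝ :=
  vecMulVec (Pi.single u 1) (Γ.burauForm v)

theorem burauRankOne_mul (Γ : LabelledGraph V) (u v u' v' : V) :
    Γ.burauRankOne u v * Γ.burauRankOne u' v' = Γ.burauForm v u' • Γ.burauRankOne u v' := by
  simp [burauRankOne, vecMulVec_mul_vecMulVec, vecMulVec_smul]

theorem det_one_sub_burauRankOne (Γ : LabelledGraph V) (v : V) :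
    (1 - Γ.burauRankOne v v).det = -4 := by
  rw [sub_eq_add_neg, burauRankOne, ← neg_vecMulVec, vecMulVec_eq Unit,
    det_one_add_replicateCol_mul_replicateRow]
  simp [burauForm_self]
  norm_num

/-- The image of a standard generator under the generalized Burau representation. -/
noncomputable def burauGen (Γ : LabelledGraph V) (v : V) : GL V ℝ :=
  GeneralLinearGroup.mkOfDetNeZero (1 - Γ.burauRankOne v v)
    (by rw [det_one_sub_burauRankOne]; norm_num)

theorem coe_burauGen (Γ : LabelledGraph V) (v : V) :
    (Γ.burauGen v : Matrix V V ℝ) = 1 - Γ.burauRankOne v v := rfl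

theorem altProd_burauGen (Γ : LabelledGraph V) {u v : V} {k : ℕ} (huv : u ≠ v)
    (hk : Γ.m u v = k) :
    altProd (Γ.burauGen u) (Γ.burauGen v) k = altProd (Γ.burauGen v) (Γ.burauGen u) k := by
  have hk2 : 2 ≤ k := by
    have := Γ.two_le u v huv
    rw [hk] at this
    exact_mod_cast this
  have hβ : Γ.burauForm u v = -2 * 2 * Real.cos (Real.pi / k) := by
    rw [burauForm, if_neg huv, hk, ENat.toNat_natCast]
    norm_num
  have hβ' : Γ.burauForm v u = -2 * 2 * Real.cos (Real.pi / k) := by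
    rw [burauForm_symm, hβ]
  have hd (w : V) : Γ.burauForm w w = 1 + 2 ^ 2 := by rw [burauForm_self]; norm_num
  refine Units.ext ?_
  have := altProd_one_sub_comm (R := Matrix V V ℝ) (two_ne_zero (α := ℝ)) hk2
    (A := Γ.burauRankOne u u) (B := Γ.burauRankOne v v)
    (X := Γ.burauRankOne u v) (Y := Γ.burauRankOne v u)
    (by rw [burauRankOne_mul, hd]) (by rw [burauRankOne_mul, hβ])
    (by rw [burauRankOne_mul, hd]) (by rw [burauRankOne_mul, hβ])
    (by rw [burauRankOne_mul, hd]) (by rw [burauRankOne_mul, hβ'])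
    (by rw [burauRankOne_mul, hd]) (by rw [burauRankOne_mul, hβ'])
  have hcoe (x y : GL V ℝ) :
      ((altProd x y k : GL V ℝ) : Matrix V V ℝ) = altProd (x : Matrix V V ℝ) y k :=
    map_altProd (Units.coeHom _) x y k
  rw [hcoe, hcoe]
  exact this

/-- The generalized Burau representation of an Artin group at parameter `q = 4`. -/
noncomputable def burau (Γ : LabelledGraph V) : Γ.ArtinGroup →* GL V ℝ :=
  PresentedGroup.toGroup (f := Γ.burauGen) (by
    rintro r ⟨u, v, k, huv, hk, rfl⟩
    rw [map_mul, map_inv, mul_inv_eq_one, altWord, altWord, map_altProd, map_altProd]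
    simpa using Γ.altProd_burauGen huv hk)

@[simp]
theorem burau_σ (Γ : LabelledGraph V) (v : V) : Γ.burau (Γ.σ v) = Γ.burauGen v :=
  PresentedGroup.toGroup.of _

theorem one_lt_abs_det_burau (Γ : LabelledGraph V) {z : Γ.ArtinGroup}
    (hz : z ∈ Submonoid.closure (Set.range Γ.σ)) :
    z = 1 ∨ 1 < |(Γ.burau z : Matrix V V ℝ).det| := by
  induction hz using Submonoid.closure_induction with
  | mem x hx =>
    obtain ⟨v, rfl⟩ := hx
    right
    rw [burau_σ, coe_burauGen, det_one_sub_burauRankOne]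
    norm_num
  | one => exact Or.inl rfl
  | mul x y _ _ hx hy =>
    rcases hx with rfl | hx
    · simpa using hy
    rcases hy with rfl | hy
    · right; simpa using hx
    · right
      rw [map_mul, Units.val_mul, det_mul, abs_mul]
      exact one_lt_mul_of_lt_of_le hx hy.le

theorem single_vecMul_burau (Γ : LabelledGraph V) {K : Set V} {r : V} (hr : r ∉ K)
    {z : Γ.ArtinGroup} (hz : z ∈ Γ.specialSubgroup K) :
    Pi.single r 1 ᵥ* (Γ.burau z : Matrix V V ℝ) = Pi.single r 1 := by
  induction hz using Subgroup.closure_induction with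
  | mem x hx =>
    obtain ⟨v, hv, rfl⟩ := hx
    have hrv : r ≠ v := by rintro rfl; exact hr hv
    rw [burau_σ, coe_burauGen, vecMul_sub, vecMul_one, burauRankOne, vecMul_vecMulVec]
    simp [hrv]
  | one => simp
  | mul x y _ _ hx hy => rw [map_mul, Units.val_mul, ← vecMul_vecMul, hx, hy]
  | inv x _ hx =>
    conv_lhs => rw [← hx]
    rw [vecMul_vecMul, map_inv, ← Units.val_mul, mul_inv_cancel, Units.val_one, vecMul_one]

theorem commute_burauRankOne (Γ : LabelledGraph V) {z : Γ.ArtinGroup} {v : V}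
    (hz : Commute z (Γ.σ v * Γ.σ v)) :
    Commute (Γ.burau z : Matrix V V ℝ) (Γ.burauRankOne v v) := by
  have h := (hz.map Γ.burau).map (Units.coeHom (Matrix V V ℝ))
  have hsq : (Units.coeHom (Matrix V V ℝ)) (Γ.burau (Γ.σ v * Γ.σ v)) =
      1 + (3 : ℝ) • Γ.burauRankOne v v := by
    rw [map_mul, map_mul, burau_σ, Units.coeHom_apply, coe_burauGen, sub_mul, mul_sub, mul_sub,
      burauRankOne_mul, burauForm_self, mul_one, one_mul, mul_one]
    module
  rw [hsq] at h
  have h' := (h.sub_right (Commute.one_right _)).smul_right (3⁻¹ : ℝ)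
  simpa [smul_smul] using h'

/-- When `Γ` is irreducible, a matrix commuting with every `burauRankOne Γ v v` and having a
diagonal entry equal to `1` is the identity. -/
theorem eq_one_of_commute_burauRankOne (Γ : LabelledGraph V) (hirr : Γ.Irreducible)
    {M : Matrix V V ℝ} (hM : ∀ v, Commute M (Γ.burauRankOne v v)) {r : V} (hr : M r r = 1) :
    M = 1 := by
  have key (v i j : V) :
      M i v * Γ.burauForm v j = (Pi.single v 1 : V → ℝ) i * (Γ.burauForm v ᵥ* M) j := by
    have := congrFun (congrFun (hM v).eq i) j
    rw [burauRankOne, mul_vecMulVec, vecMulVec_mul, mulVec_single_one] at this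
    simpa [vecMulVec_apply] using this
  have hoff (i v : V) (h : i ≠ v) : M i v = 0 := by
    simpa [burauForm_self, h] using key v i v
  have hdiag (u v : V) : M u u * Γ.burauForm u v = Γ.burauForm u v * M v v := by
    rw [key u u v, Pi.single_eq_same, one_mul, vecMul, dotProduct,
      Finset.sum_eq_single v (fun w _ hw => by rw [hoff w v hw, mul_zero]) (by simp)]
  have hone (v : V) : M v v = 1 := by
    by_contra hv
    refine hirr ⟨{w | M w w = 1}, {w | M w w = 1}ᶜ, ⟨r, hr⟩, ⟨v, hv⟩, disjoint_compl_right,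
      Set.union_compl_self _, fun u hu w hw => ?_⟩
    by_contra hm
    have huw : u ≠ w := by rintro rfl; exact hw hu
    have hu' : M u u = 1 := hu
    have := hdiag u w
    rw [hu', mul_comm] at this
    exact hw (mul_left_cancel₀ (Γ.burauForm_ne_zero huw hm) this).symm
  ext i j
  rcases eq_or_ne i j with rfl | hij
  · rw [hone, one_apply_eq]
  · rw [hoff i j hij, one_apply_ne hij]

end Burau

theorem σ_mul_self_mem_pureArtinGroup (Γ : LabelledGraph V) (v : V) :
    Γ.σ v * Γ.σ v ∈ Γ.pureArtinGroup :=
  (QuotientGroup.eq_one_iff _).mpr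
    (Subgroup.subset_normalClosure (Set.mem_union_right _ ⟨v, rfl⟩))

end LabelledGraph

/-- Let `Γ` be irreducible and let `z ∈ A_Γ` be a positive element
(a product of generators with no inverses) such that either `z` is central in `A_Γ`
of infinite order, or `z` is a nontrivial central element of the pure Artin group
`PA_Γ`. Then there is no proper subset `K ⊊ V` with `z ∈ A_K`. -/
theorem positive_central_not_in_proper_special_subgroup {V : Type*} [Finite V]
    (Γ : LabelledGraph V) (hirr : Γ.Irreducible) (z : Γ.ArtinGroup)
    (hpos : z ∈ Submonoid.closure (Set.range Γ.σ))
    (hz : (z ∈ Subgroup.center Γ.ArtinGroup ∧ ¬ IsOfFinOrder z) ∨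
          (z ∈ Γ.pureArtinGroup ∧ z ≠ 1 ∧ ∀ w ∈ Γ.pureArtinGroup, z * w = w * z)) :
    ∀ K : Set V, K ≠ Set.univ → z ∉ Γ.specialSubgroup K := by
  classical
  have := Fintype.ofFinite V
  intro K hK hzK
  obtain ⟨r, hr⟩ := (Set.ne_univ_iff_exists_notMem K).mp hK
  have hne : z ≠ 1 := by
    rcases hz with ⟨-, h⟩ | ⟨-, h, -⟩
    · rintro rfl
      exact h IsOfFinOrder.one
    · exact h
  have hcomm (v : V) : Commute z (Γ.σ v * Γ.σ v) := by
    rcases hz with ⟨h, -⟩ | ⟨-, -, h⟩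
    · exact (Subgroup.mem_center_iff.mp h _).symm
    · exact h _ (Γ.σ_mul_self_mem_pureArtinGroup v)
  have hrr : (Γ.burau z : Matrix V V ℝ) r r = 1 := by
    simpa using congrFun (Γ.single_vecMul_burau hr hzK) r
  have hone := Γ.eq_one_of_commute_burauRankOne hirr
    (fun v => Γ.commute_burauRankOne (hcomm v)) hrr
  have hdet := (Γ.one_lt_abs_det_burau hpos).resolve_left hne
  simp [hone] at hdet
end
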